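/- arXiv:2507.11291 — 10 statements merged into one kernel-verified Lean document; each statement's English description precedes it below -/
import Mathlib

section
/- Let k ≥ 4, let π be the increasing pattern 12…k, and let n be an even integer with n ≥ k². Then every deterministic single-pass streaming algorithm that solves π-PPM_n has at least binomial(n/2 − 1, k − 3) states; in particular it requires Ω(k log n) bits of space. -/
/-- `Contains τ π`: the sequence `τ` contains the pattern `π`, i.e. some subsequence of `τ`
is order-isomorphic to `π`. -/
def Contains (τ π : List ℕ) : Prop :=
  ∃ f : Fin π.length → Fin τ.length, StrictMono f ∧
    ∀ j l : Fin π.length, (τ.get (f j) < τ.get (f l) ↔ π.get j < π.get l)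

/-- The increasing pattern `1 2 … k`. -/
def IncPattern (k : ℕ) : List ℕ := List.range' 1 k

/-- The decreasing pattern `k (k-1) … 1`. -/
def DecPattern (k : ℕ) : List ℕ := (List.range' 1 k).reverse

/-- A pattern is a permutation of `[k] = {1,…,k}` where `k` is its length. -/
def IsPattern (π : List ℕ) : Prop := π.Perm (List.range' 1 π.length)

/-- `τ` is a permutation of `[n] = {1,…,n}`. -/
def IsPermOf (n : ℕ) (τ : List ℕ) : Prop := τ.Perm (List.range' 1 n)

/-- `τ` is a sequence of pairwise distinct values from `[n]`. -/
def IsDistinctSeqIn (n : ℕ) (τ : List ℕ) : Prop :=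
  τ.Nodup ∧ ∀ x ∈ τ, 1 ≤ x ∧ x ≤ n

/-- A deterministic single-pass streaming algorithm with state set `Q`:
initial state, accepting states, transition function. -/
structure StreamAlg (Q : Type) where
  q0 : Q
  F : Set Q
  t : Q → ℕ → Q

/-- The state reached by the algorithm after reading the input `τ`. -/
def StreamAlg.run {Q : Type} (A : StreamAlg Q) (τ : List ℕ) : Q :=
  τ.foldl A.t A.q0

/-- The algorithm accepts the input `τ`. -/
def StreamAlg.Accepts {Q : Type} (A : StreamAlg Q) (τ : List ℕ) : Prop :=
  A.run τ ∈ A.F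

/-- `A` solves `π`-PPM_n : it accepts a permutation `τ` of `[n]` iff `τ` contains `π`. -/
def SolvesPPM {Q : Type} (A : StreamAlg Q) (n : ℕ) (π : List ℕ) : Prop :=
  ∀ τ : List ℕ, IsPermOf n τ → (A.Accepts τ ↔ Contains τ π)

/-- `A` solves `π`-SequencePPM_n : it accepts a sequence `τ` of pairwise distinct values
from `[n]` iff `τ` contains `π`. -/
def SolvesSeqPPM {Q : Type} (A : StreamAlg Q) (n : ℕ) (π : List ℕ) : Prop :=
  ∀ τ : List ℕ, IsDistinctSeqIn n τ → (A.Accepts τ ↔ Contains τ π)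

open Finset

lemma incPattern_get_lt_get_iff {k : ℕ} (i j : Fin (IncPattern k).length) :
    (IncPattern k).get i < (IncPattern k).get j ↔ i < j := by
  unfold IncPattern at i j ⊢
  simp

/-- A sequence with an increasing subsequence of length at least `k` contains `12…k`. -/
lemma contains_incPattern_of_sublist {k : ℕ} {l τ : List ℕ} (hl : l.Sublist τ)
    (hinc : l.Pairwise (· < ·)) (hk : k ≤ l.length) : Contains τ (IncPattern k) := by
  obtain ⟨f, hf⟩ := List.sublist_iff_exists_fin_orderEmbedding_get_eq.1 hl
  have hlen : (IncPattern k).length ≤ l.length := by simpa [IncPattern] using hk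
  have hmono : StrictMono l.get := fun i j hij => List.pairwise_iff_get.1 hinc i j hij
  refine ⟨fun j => f (Fin.castLE hlen j), fun i j hij => f.strictMono (by simpa using hij), ?_⟩
  intro i j
  rw [← hf, ← hf, hmono.lt_iff_lt, incPattern_get_lt_get_iff]
  rfl

/-- If some labelling with values below `k - 1` strictly increases along every ascent of `τ`,
then `τ` avoids `12…k`. -/
lemma not_contains_incPattern_of_label {k : ℕ} {τ : List ℕ} (hk0 : 0 < k) (L : ℕ → ℕ)
    (hL : τ.Pairwise (fun x y => x < y → L x < L y)) (hk : ∀ x ∈ τ, L x + 1 < k) :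
    ¬ Contains τ (IncPattern k) := by
  rintro ⟨f, hf, h⟩
  have hlen : (IncPattern k).length = k := by simp [IncPattern]
  have hmono : StrictMono fun j => L (τ.get (f j)) := fun i j hij =>
    List.pairwise_iff_get.1 hL _ _ (hf hij) ((h i j).2 ((incPattern_get_lt_get_iff i j).2 hij))
  have hcard := Finset.card_le_card_of_injOn (s := univ) (t := range (k - 1))
    (fun j => L (τ.get (f j)))
    (fun j _ => by
      have := hk _ (τ.get_mem (f j))
      simp only [coe_range, Set.mem_Iio]
      omega)
    hmono.injective.injOn
  simp only [card_univ, Fintype.card_fin, hlen, card_range] at hcard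
  omega

/-- The number of elements of `T` below `x`. -/
def countBelow (T : Finset ℕ) (x : ℕ) : ℕ := #{t ∈ T | t < x}

lemma countBelow_le_card (T : Finset ℕ) (x : ℕ) : countBelow T x ≤ #T :=
  card_filter_le _ _

lemma countBelow_lt_countBelow {T : Finset ℕ} {x y t : ℕ} (ht : t ∈ T) (hxt : x ≤ t)
    (hty : t < y) : countBelow T x < countBelow T y := by
  refine card_lt_card (Finset.ssubset_iff_of_subset ?_ |>.2 ⟨t, ?_, ?_⟩)
  · exact monotone_filter_right _ fun a _ ha => by omega
  · simp [ht, hty]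
  · simp [hxt]

/-- The odd values of `[n]`, those outside `S` decreasing and then those in `S` increasing. -/
def oddPrefix (n : ℕ) (S : Finset ℕ) : List ℕ :=
  ({x ∈ Icc 1 n | Odd x ∧ x ∉ S} : Finset ℕ).sort (· ≥ ·) ++ S.sort

/-- The increasing run used to test a set: `w` and the successors of the elements of `T`
above `w`. -/
def testRun (T : Finset ℕ) (w : ℕ) : Finset ℕ :=
  insert w ({t ∈ T | w < t}.image (· + 1))

/-- The even values of `[n]`: the values above `w` outside the test run decreasing, then the
test run increasing, then the values below `w` decreasing. -/
def evenSuffix (n : ℕ) (T : Finset ℕ) (w : ℕ) : List ℕ :=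
  ({x ∈ Icc 1 n | Even x ∧ w < x ∧ x ∉ testRun T w} : Finset ℕ).sort (· ≥ ·) ++
    ((testRun T w).sort ++ ({x ∈ Icc 1 n | Even x ∧ x < w} : Finset ℕ).sort (· ≥ ·))

lemma mem_testRun {T : Finset ℕ} {w x : ℕ} :
    x ∈ testRun T w ↔ x = w ∨ ∃ t ∈ T, w < t ∧ t + 1 = x := by
  simp [testRun, and_assoc]

lemma even_and_le_of_mem_testRun {n w x : ℕ} {T : Finset ℕ} (hn : Even n) (hwn : w ≤ n)
    (hw : Even w) (hT : ∀ t ∈ T, Odd t ∧ t ≤ n) (hx : x ∈ testRun T w) :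
    Even x ∧ w ≤ x ∧ x ≤ n := by
  rcases mem_testRun.1 hx with rfl | ⟨t, ht, hwt, rfl⟩
  · exact ⟨hw, le_rfl, hwn⟩
  · obtain ⟨ho, hle⟩ := hT t ht
    refine ⟨ho.add_one, by omega, ?_⟩
    rcases hn with ⟨a, rfl⟩
    rcases ho with ⟨b, rfl⟩
    omega

lemma isPermOf_oddPrefix_append_evenSuffix {n w : ℕ} {S T : Finset ℕ} (hn : Even n)
    (hw : Even w) (hw0 : 0 < w) (hwn : w ≤ n) (hS : ∀ s ∈ S, Odd s ∧ s ≤ n)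
    (hT : ∀ t ∈ T, Odd t ∧ t ≤ n) :
    IsPermOf n (oddPrefix n S ++ evenSuffix n T w) := by
  have hC := fun x => even_and_le_of_mem_testRun (x := x) hn hwn hw hT
  refine (List.perm_ext_iff_of_nodup ?_ (List.nodup_range' ..)).2 fun x => ?_
  · simp only [oddPrefix, evenSuffix, List.nodup_append, sort_nodup, mem_sort, mem_filter,
      List.mem_append, true_and]
    grind
  · simp only [oddPrefix, evenSuffix, List.mem_append, mem_sort, mem_filter, mem_Icc,
      List.mem_range'_1]
    have hmem : w ∈ testRun T w := mem_testRun.2 (.inl rfl)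
    grind

lemma contains_oddPrefix_append_evenSuffix {n k w : ℕ} {S T : Finset ℕ}
    (hn : Even n) (hw : Even w) (hwn : w ≤ n)
    (hT : ∀ t ∈ T, Odd t ∧ t ≤ n) (hk : k ≤ #T + 2)
    (hlt : countBelow T w < countBelow S w) :
    Contains (oddPrefix n S ++ evenSuffix n T w) (IncPattern k) := by
  have hC := fun x => even_and_le_of_mem_testRun (x := x) hn hwn hw hT
  have hsub : ((({s ∈ S | s < w} : Finset ℕ).sort) ++ (testRun T w).sort).Sublist
      (oddPrefix n S ++ evenSuffix n T w) := by
    refine List.Sublist.append (.trans ?_ (List.sublist_append_right ..))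
      (.trans (List.sublist_append_left ..) (List.sublist_append_right ..))
    refine List.sublist_of_subperm_of_pairwise (List.subperm_of_subset (sort_nodup _ _) ?_)
      (pairwise_sort _ _) (pairwise_sort _ _)
    intro x hx
    rw [mem_sort] at hx ⊢
    exact (mem_filter.1 hx).1
  refine contains_incPattern_of_sublist hsub ?_ ?_
  · simp only [List.pairwise_append, mem_sort, mem_filter]
    refine ⟨(sortedLT_sort _).pairwise, (sortedLT_sort _).pairwise, fun a ha b hb => ?_⟩
    have := hC b hb
    omega
  · have hnot : w ∉ {t ∈ T | w < t}.image (· + 1) := by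
      simp only [mem_image, mem_filter, not_exists]
      omega
    have hsplit := card_filter_add_card_filter_not (s := T) (· < w)
    have hge : ({t ∈ T | ¬ t < w} : Finset ℕ) = {t ∈ T | w < t} := by
      refine filter_congr fun t ht => ?_
      have : t ≠ w := by
        rintro rfl
        exact Nat.not_even_iff_odd.2 (hT t ht).1 hw
      omega
    rw [hge] at hsplit
    simp only [List.length_append, length_sort, testRun, card_insert_of_notMem hnot,
      card_image_of_injective _ (add_left_injective 1)]
    unfold countBelow at hlt
    omega

lemma not_contains_oddPrefix_append_evenSuffix {n k w : ℕ} {T : Finset ℕ}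
    (hn : Even n) (hw : Even w) (hwn : w ≤ n)
    (hT : ∀ t ∈ T, Odd t ∧ t ≤ n) (h1 : 1 ∈ T) (hk : #T + 2 ≤ k) :
    ¬ Contains (oddPrefix n T ++ evenSuffix n T w) (IncPattern k) := by
  have hC := fun x => even_and_le_of_mem_testRun (x := x) hn hwn hw hT
  refine not_contains_incPattern_of_label (by omega)
    (fun x => if Odd x ∧ x ∉ T then 0 else countBelow T x) ?_ ?_
  · have hstep : ∀ x t y, t ∈ T → x ≤ t → t < y → countBelow T x < countBelow T y :=
      fun _ _ _ => countBelow_lt_countBelow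
    have hpos : ∀ y, 1 < y → 0 < countBelow T y := fun y hy =>
      (Nat.zero_le _).trans_lt (hstep 1 1 y h1 le_rfl hy)
    have hrun : ∀ x y, Even x → w ≤ x → x < y → y ∈ testRun T w →
        countBelow T x < countBelow T y := by
      intro x y hx hwx hxy hy
      rcases mem_testRun.1 hy with rfl | ⟨t, ht, hwt, rfl⟩
      · omega
      · exact hstep x t _ ht (by omega) (by omega)
    have hdec : ∀ (s : Finset ℕ) (L : ℕ → ℕ),
        (s.sort (· ≥ ·)).Pairwise (fun x y => x < y → L x < L y) := fun s L =>
      (pairwise_sort s (· ≥ ·)).imp fun h h' => absurd h' (not_lt.2 h)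
    simp only [oddPrefix, evenSuffix, List.pairwise_append, hdec, mem_sort, List.mem_append,
      mem_filter, mem_Icc, true_and]
    refine ⟨⟨?_, ?_⟩, ⟨⟨?_, ?_⟩, ?_⟩, ?_⟩
    · refine (pairwise_sort T (· ≤ ·)).imp_of_mem fun {x y} hx hy _ hxy => ?_
      rw [mem_sort] at hx hy
      simpa [hx, hy] using hstep x x y hx le_rfl hxy
    · grind
    · refine (pairwise_sort (testRun T w) (· ≤ ·)).imp_of_mem fun {x y} hx hy _ hxy => ?_
      rw [mem_sort] at hx hy
      have hxe := hC x hx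
      have hye := hC y hy
      simpa [Nat.not_odd_iff_even.2 hxe.1, Nat.not_odd_iff_even.2 hye.1] using
        hrun x y hxe.1 hxe.2.1 hxy hy
    · grind
    · grind
    · grind
  · intro x _
    have := countBelow_le_card T x
    split_ifs <;> omega

/-- Prefixes coding distinct sets drive the algorithm to distinct states. -/
lemma run_oddPrefix_ne {n k x : ℕ} {Q : Type} {A : StreamAlg Q} {S T : Finset ℕ}
    (hA : SolvesPPM A n (IncPattern k)) (hn : Even n)
    (hS : ∀ s ∈ S, Odd s ∧ s ≤ n) (hT : ∀ t ∈ T, Odd t ∧ t ≤ n) (h1 : 1 ∈ T)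
    (hk : #T + 2 = k) (hxS : x ∈ S) (hxT : x ∉ T) (hagree : ∀ y < x, y ∈ S ↔ y ∈ T) :
    A.run (oddPrefix n S) ≠ A.run (oddPrefix n T) := by
  intro h
  obtain ⟨hxo, hxn⟩ := hS x hxS
  have hw : Even (x + 1) := hxo.add_one
  have hwn : x + 1 ≤ n := by
    rcases hn with ⟨a, rfl⟩
    rcases hxo with ⟨b, rfl⟩
    omega
  have hlt : countBelow T (x + 1) < countBelow S (x + 1) := by
    refine card_lt_card (Finset.ssubset_iff_of_subset ?_ |>.2 ⟨x, ?_, ?_⟩)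
    · intro y
      grind
    · simp [hxS]
    · simp [hxT]
  have hacc : A.Accepts (oddPrefix n S ++ evenSuffix n T (x + 1)) :=
    (hA _ (isPermOf_oddPrefix_append_evenSuffix hn hw (by omega) hwn hS hT)).2
      (contains_oddPrefix_append_evenSuffix hn hw hwn hT hk.ge hlt)
  refine not_contains_oddPrefix_append_evenSuffix hn hw hwn hT h1 hk.le
    ((hA _ (isPermOf_oddPrefix_append_evenSuffix hn hw (by omega) hwn hT hT)).1 ?_)
  unfold StreamAlg.Accepts at hacc ⊢
  unfold StreamAlg.run at hacc h ⊢
  rw [List.foldl_append] at hacc ⊢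
  rwa [← h]

/-- For `k ≥ 4`, `π = 12…k`, and even `n ≥ k²`, every deterministic single-pass
streaming algorithm solving `π`-PPM_n has at least `binomial(n/2 − 1, k − 3)` states. -/
theorem stmt1 (n k : ℕ) (hk : 4 ≤ k) (hn : Even n) (hnk : k ^ 2 ≤ n)
    (Q : Type) [Fintype Q] (A : StreamAlg Q)
    (hA : SolvesPPM A n (IncPattern k)) :
    Nat.choose (n / 2 - 1) (k - 3) ≤ Fintype.card Q := by
  set B : Finset ℕ := (range (n / 2 - 1)).image fun i => 2 * i + 3 with hB
  have hBcard : #B = n / 2 - 1 := by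
    rw [hB, card_image_of_injective _ fun i j hij => by simpa using hij, card_range]
  have h1B : 1 ∉ B := by simp [hB]
  have hodd : ∀ S ∈ B.powersetCard (k - 3), ∀ s ∈ insert 1 S, Odd s ∧ s ≤ n := by
    intro S hS s hs
    rcases mem_insert.1 hs with rfl | hs
    · exact ⟨odd_one, by nlinarith⟩
    · obtain ⟨i, hi, rfl⟩ := mem_image.1 ((mem_powersetCard.1 hS).1 hs)
      rw [mem_range] at hi
      exact ⟨⟨i + 1, by ring⟩, by omega⟩
  have hnotMem : ∀ S ∈ B.powersetCard (k - 3), 1 ∉ S := fun S hS h =>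
    h1B ((mem_powersetCard.1 hS).1 h)
  have hcard : ∀ S ∈ B.powersetCard (k - 3), #(insert 1 S) + 2 = k := by
    intro S hS
    rw [card_insert_of_notMem (hnotMem S hS), (mem_powersetCard.1 hS).2]
    omega
  rw [← hBcard, ← card_powersetCard, ← card_univ]
  refine card_le_card_of_injOn (fun S => A.run (oddPrefix n (insert 1 S))) (by simp) ?_
  intro S hS T hT h
  by_contra hne
  have hex : ∃ x, ¬ (x ∈ insert 1 S ↔ x ∈ insert 1 T) := by
    by_contra! hall
    have := hnotMem S hS
    have := hnotMem T hT
    exact hne (by ext x; have := hall x; grind)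
  have hmin : ∀ y < Nat.find hex, y ∈ insert 1 S ↔ y ∈ insert 1 T := fun y hy =>
    not_not.1 (Nat.find_min hex hy)
  by_cases hxS : Nat.find hex ∈ insert 1 S
  · exact run_oddPrefix_ne hA hn (hodd S hS) (hodd T hT) (mem_insert_self _ _) (hcard T hT) hxS
      (fun hxT => Nat.find_spec hex (iff_of_true hxS hxT)) hmin h
  · refine run_oddPrefix_ne hA hn (hodd T hT) (hodd S hS) (mem_insert_self _ _) (hcard S hS)
      (by_contra fun hxT => Nat.find_spec hex (iff_of_false hxS hxT)) hxS
      (fun y hy => (hmin y hy).symm) h.symm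
end

section
/- Let A be a deterministic single-pass streaming algorithm with state set Q that solves 21-PPM_n, and let q₀, q₁, …, q_n be the sequence of states that A traverses on the input permutation 1, 2, …, n (the identity). Then the consecutive pairs (q_i, q_{i+1}), for i = 0, 1, …, n−1, are pairwise distinct; consequently |Q|² ≥ n. -/
/-- A sequence contains `21` iff it is not weakly increasing. -/
theorem contains_two_one_iff (τ : List ℕ) : Contains τ [2, 1] ↔ ¬ τ.Pairwise (· ≤ ·) := by
  rw [List.pairwise_iff_get]
  constructor
  · rintro ⟨f, hf, h⟩ hp
    have hlt : τ.get (f (1 : Fin 2)) < τ.get (f (0 : Fin 2)) :=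
      (h (1 : Fin 2) (0 : Fin 2)).2 (by decide)
    have hle := hp (f (0 : Fin 2)) (f (1 : Fin 2)) (hf (by decide))
    omega
  · intro hp
    push Not at hp
    obtain ⟨a, b, hab, hlt⟩ := hp
    refine ⟨(![a, b] : Fin 2 → Fin τ.length), ?_, ?_⟩
    · change StrictMono (![a, b] : Fin 2 → Fin τ.length)
      rw [Fin.strictMono_iff_lt_succ]
      intro k
      fin_cases k
      exact hab
    · change ∀ j l : Fin 2, τ.get ((![a, b] : Fin 2 → Fin τ.length) j) <
        τ.get ((![a, b] : Fin 2 → Fin τ.length) l) ↔ [2, 1].get j < [2, 1].get l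
      simp only [Fin.forall_fin_two]
      simp at hlt ⊢
      omega

theorem StreamAlg.run_append {Q : Type} (A : StreamAlg Q) (σ τ : List ℕ) :
    A.run (σ ++ τ) = τ.foldl A.t (A.run σ) :=
  List.foldl_append

theorem perm_swap {α : Type*} (x y : α) (l₁ l₂ l₃ : List α) :
    (l₁ ++ (y :: (l₂ ++ (x :: l₃)))).Perm (l₁ ++ (x :: (l₂ ++ (y :: l₃)))) := by
  refine List.Perm.append_left l₁ ?_
  refine (List.perm_middle.cons y).trans ?_
  refine (List.Perm.swap x y _).trans ?_
  exact List.perm_middle.symm.cons x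

theorem range'_split (i d e : ℕ) :
    List.range' 1 (i + 1 + d + 1 + e) = List.range' 1 i ++ ((i + 1) ::
      (List.range' (i + 2) d ++ ((i + d + 2) :: List.range' (i + d + 3) e))) := by
  have cons_range' (a k : ℕ) : a :: List.range' (a + 1) k = List.range' a (k + 1) :=
    List.range'_succ.symm
  rw [cons_range', show i + d + 2 = i + 2 + d by omega, List.range'_append_1,
    cons_range' (i + 1), add_comm i 1, List.range'_append_1]
  congr 1
  omega

/-- Two different steps of the run on the identity do not traverse the same pair of states. -/
theorem SolvesPPM.consecutive_states_ne {n : ℕ} {Q : Type} {A : StreamAlg Q}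
    (hA : SolvesPPM A n [2, 1]) {i j : ℕ} (hij : i < j) (hj : j < n)
    (h : A.run (List.range' 1 i) = A.run (List.range' 1 j)) :
    A.run (List.range' 1 (i + 1)) ≠ A.run (List.range' 1 (j + 1)) := by
  intro h'
  obtain ⟨d, rfl⟩ : ∃ d, j = i + 1 + d := ⟨j - (i + 1), by omega⟩
  obtain ⟨e, rfl⟩ : ∃ e, n = i + 1 + d + 1 + e := ⟨n - (i + 1 + d + 1), by omega⟩
  have step (a : ℕ) : A.t (A.run (List.range' 1 a)) (a + 1) = A.run (List.range' 1 (a + 1)) := by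
    rw [List.range'_1_concat, A.run_append, add_comm 1 a]
    rfl
  have steps (a k : ℕ) : (List.range' (a + 1) k).foldl A.t (A.run (List.range' 1 a)) =
      A.run (List.range' 1 (a + k)) := by
    rw [← A.run_append, add_comm a 1, List.range'_append_1]
  set τ := List.range' 1 i ++ ((i + d + 2) ::
      (List.range' (i + 2) d ++ ((i + 1) :: List.range' (i + d + 3) e))) with hτ
  have hperm : IsPermOf (i + 1 + d + 1 + e) τ := by
    rw [IsPermOf, range'_split]
    exact perm_swap _ _ _ _ _
  have hrun : A.run τ = A.run (List.range' 1 (i + 1 + d + 1 + e)) := by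
    rw [hτ, A.run_append, List.foldl_cons, List.foldl_append, List.foldl_cons, h,
      show i + d + 2 = i + 1 + d + 1 by omega, step, ← h', steps (i + 1) d, ← h, step, h',
      show i + d + 3 = i + 1 + d + 1 + 1 by omega, steps]
  have hcontains : Contains τ [2, 1] := by
    rw [contains_two_one_iff]
    intro hp
    have hle := (List.pairwise_cons.1 (List.pairwise_append.1 hp).2.1).1 (i + 1) (by simp)
    omega
  have hid : A.Accepts (List.range' 1 (i + 1 + d + 1 + e)) := by
    rw [StreamAlg.Accepts, ← hrun]
    exact (hA τ hperm).2 hcontains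
  exact (contains_two_one_iff _).1 ((hA _ (List.Perm.refl _)).1 hid) List.pairwise_le_range'

/-- If `A` solves 21-PPM_n and `q_i` is the state of `A` after reading the prefix
`1, 2, …, i` of the identity permutation, then the consecutive pairs `(q_i, q_{i+1})`
for `i = 0, …, n−1` are pairwise distinct; consequently `|Q|² ≥ n`. -/
theorem stmt3 (n : ℕ) (Q : Type) [Fintype Q] (A : StreamAlg Q)
    (hA : SolvesPPM A n [2, 1]) :
    (∀ i j, i < n → j < n →
        A.run (List.range' 1 i) = A.run (List.range' 1 j) →
        A.run (List.range' 1 (i + 1)) = A.run (List.range' 1 (j + 1)) →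
        i = j) ∧
    n ≤ Fintype.card Q ^ 2 := by
  have inj : ∀ i j, i < n → j < n →
      A.run (List.range' 1 i) = A.run (List.range' 1 j) →
      A.run (List.range' 1 (i + 1)) = A.run (List.range' 1 (j + 1)) → i = j := by
    intro i j hi hj h h'
    rcases lt_trichotomy i j with hij | hij | hij
    · exact absurd h' (hA.consecutive_states_ne hij hj h)
    · exact hij
    · exact absurd h'.symm (hA.consecutive_states_ne hij hi h.symm)
  refine ⟨inj, ?_⟩
  have hcard := Fintype.card_le_of_injective
    (fun i : Fin n => (A.run (List.range' 1 i), A.run (List.range' 1 (i + 1))))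
    (fun i j h => Fin.ext (inj i j i.2 j.2 (Prod.ext_iff.1 h).1 (Prod.ext_iff.1 h).2))
  rwa [Fintype.card_fin, Fintype.card_prod, ← sq] at hcard
end

section
/- Let π be a pattern of length k ≥ 1 and let π' be a pattern of length k+1 such that the prefix π'(1)…π'(k) is order-isomorphic to π and π'(k) > π'(k+1). For a permutation τ of [n], let τ' be the permutation of [2n] defined by τ'(i) = 2·τ(i) for i ∈ [n] and τ'(n+j) = 2j−1 for j ∈ [n]. Then τ' contains π' if and only if τ contains π. -/
/-- Two sequences of the same length are order-isomorphic: corresponding entries compare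
the same way. -/
def OrderIsoSeq (σ π : List ℕ) : Prop :=
  σ.length = π.length ∧
  ∀ i j, i < σ.length → j < σ.length → (σ.getD i 0 < σ.getD j 0 ↔ π.getD i 0 < π.getD j 0)

theorem getElem_double_append_odds_of_lt {n : ℕ} {τ : List ℕ} {i : ℕ} (hi : i < τ.length)
    (h : i < (τ.map (fun x => 2 * x) ++ List.range' 1 n 2).length) :
    (τ.map (fun x => 2 * x) ++ List.range' 1 n 2)[i] = 2 * τ[i] := by
  rw [List.getElem_append_left (by simpa using hi), List.getElem_map]

theorem getElem_double_append_odds_of_le {n : ℕ} {τ : List ℕ} {i : ℕ} (hi : τ.length ≤ i)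
    (h : i < (τ.map (fun x => 2 * x) ++ List.range' 1 n 2).length) :
    (τ.map (fun x => 2 * x) ++ List.range' 1 n 2)[i] = 1 + 2 * (i - τ.length) := by
  rw [List.getElem_append_right (by simpa using hi), List.getElem_range']
  simp

/-- Let `π` be a pattern of length `k ≥ 1` and `π'` a pattern of length `k+1`
whose first `k` entries are order-isomorphic to `π` and with `π'(k) > π'(k+1)`. For a
permutation `τ` of `[n]`, let `τ'` be the permutation of `[2n]` obtained by doubling every
value of `τ` and then appending `1, 3, 5, …, 2n−1`. Then `τ'` contains `π'` iff `τ`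
contains `π`. -/
theorem stmt7 (k : ℕ) (hk : 1 ≤ k) (π π' : List ℕ)
    (hπ : IsPattern π) (hπ' : IsPattern π')
    (hπlen : π.length = k) (hπ'len : π'.length = k + 1)
    (hprefix : OrderIsoSeq (π'.take k) π)
    (hlast : π'.getD k 0 < π'.getD (k - 1) 0)
    (n : ℕ) (τ : List ℕ) (hτ : IsPermOf n τ) :
    Contains (τ.map (fun x => 2 * x) ++ List.range' 1 n 2) π' ↔ Contains τ π := by
  subst hπlen
  have hτlen : τ.length = n := by simpa using hτ.length_eq
  have hτmem : ∀ i (hi : i < τ.length), 1 ≤ τ[i] ∧ τ[i] ≤ n := by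
    intro i hi
    have h := hτ.mem_iff.1 (List.getElem_mem hi)
    rw [List.mem_range'_1] at h
    omega
  have hpre : ∀ i j (hi : i < π.length) (hj : j < π.length),
      (π'[i] < π'[j] ↔ π[i] < π[j]) := by
    intro i j hi hj
    have h := hprefix.2 i j (by simp; omega) (by simp; omega)
    simpa [List.getD_eq_getElem?_getD, List.getElem?_take, hi, hj,
      (by omega : i < π'.length), (by omega : j < π'.length)] using h
  have hlast' : π'[π.length] < π'[π.length - 1] := by
    simpa [List.getD_eq_getElem?_getD, (by omega : π.length < π'.length),
      (by omega : π.length - 1 < π'.length)] using hlast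
  constructor
  · rintro ⟨f, hf, hord⟩
    simp only [List.get_eq_getElem] at hord
    have hlt : f ⟨π.length - 1, by omega⟩ < τ.length := by
      by_contra! hge
      have hstep : f ⟨π.length - 1, by omega⟩ < f ⟨π.length, by omega⟩ :=
        hf (by simp only [Fin.mk_lt_mk]; omega)
      have hstep' : (f ⟨π.length - 1, by omega⟩ : ℕ) < f ⟨π.length, by omega⟩ := hstep
      have h := (hord ⟨π.length, by omega⟩ ⟨π.length - 1, by omega⟩).2 hlast'
      rw [getElem_double_append_odds_of_le (by omega),
        getElem_double_append_odds_of_le hge] at h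
      omega
    have hlt' : ∀ j : Fin π.length, (f ⟨j, by omega⟩ : ℕ) < τ.length := by
      intro j
      have h : f ⟨j, by omega⟩ ≤ f ⟨π.length - 1, by omega⟩ :=
        hf.monotone (by simp only [Fin.mk_le_mk]; omega)
      exact lt_of_le_of_lt h hlt
    refine ⟨fun j => ⟨f ⟨j, by omega⟩, hlt' j⟩, fun a b hab => ?_, fun a b => ?_⟩
    · exact hf (show (⟨a, by omega⟩ : Fin π'.length) < ⟨b, by omega⟩ from hab)
    · have h := hord ⟨a, by omega⟩ ⟨b, by omega⟩
      rw [getElem_double_append_odds_of_lt (hlt' a),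
        getElem_double_append_odds_of_lt (hlt' b), hpre a b a.2 b.2] at h
      simp only [List.get_eq_getElem]
      rw [← h]
      omega
  · rintro ⟨f, hf, hord⟩
    simp only [List.get_eq_getElem] at hord
    let m := (Finset.univ.filter fun j : Fin π.length => π'[(j : ℕ)] < π'[π.length]).sup
      fun j => τ[(f j : ℕ)]
    have hle : ∀ j : Fin π.length, π'[(j : ℕ)] < π'[π.length] → τ[(f j : ℕ)] ≤ m := fun j hj =>
      Finset.le_sup (f := fun j => τ[(f j : ℕ)]) (by simpa using hj)
    have hgt : ∀ j : Fin π.length, π'[π.length] < π'[(j : ℕ)] → m < τ[(f j : ℕ)] := by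
      intro j hj
      refine (Finset.sup_lt_iff (hτmem _ (f j).2).1).2 fun i hi => ?_
      rw [Finset.mem_filter] at hi
      exact (hord i j).2 ((hpre i j i.2 j.2).1 (hi.2.trans hj))
    have hnodup : π'.Nodup := hπ'.nodup_iff.2 (List.nodup_range' (s := 1) (n := π'.length))
    have hne : ∀ j : Fin π.length, π'[(j : ℕ)] ≠ π'[π.length] := fun j h =>
      absurd (hnodup.getElem_inj_iff.1 h) j.2.ne
    have hmn : m < n :=
      (hgt ⟨π.length - 1, by omega⟩ hlast').trans_le (hτmem _ (Fin.isLt _)).2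
    let g : ℕ → ℕ := fun j => if h : j < π.length then f ⟨j, h⟩ else n + m
    have hg : ∀ j, g j < (τ.map (fun x => 2 * x) ++ List.range' 1 n 2).length := by
      intro j
      simp only [List.length_append, List.length_map, List.length_range', g]
      split_ifs <;> omega
    have hval : ∀ j (hj : j < π.length),
        (τ.map (fun x => 2 * x) ++ List.range' 1 n 2)[g j]'(hg j) = 2 * τ[(f ⟨j, hj⟩ : ℕ)] := by
      intro j hj
      have hgj : g j = f ⟨j, hj⟩ := dif_pos hj
      simp only [hgj]
      exact getElem_double_append_odds_of_lt (f ⟨j, hj⟩).2 _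
    have hval' : (τ.map (fun x => 2 * x) ++ List.range' 1 n 2)[g π.length]'(hg _) = 1 + 2 * m := by
      have hgl : g π.length = n + m := dif_neg (lt_irrefl _)
      rw [getElem_double_append_odds_of_le (by omega), hgl]
      omega
    refine ⟨fun j => ⟨g j, hg j⟩, fun a b hab => ?_, fun a b => ?_⟩
    · have hab' : (a : ℕ) < b := hab
      have ha : (a : ℕ) < π.length := by omega
      simp only [Fin.mk_lt_mk, g, dif_pos ha]
      split_ifs with hb
      · exact hf (Fin.mk_lt_mk.2 hab')
      · omega
    · obtain ⟨a, ha⟩ := a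
      obtain ⟨b, hb⟩ := b
      simp only [List.get_eq_getElem]
      rcases Nat.lt_or_ge a π.length with ha' | ha' <;>
        rcases Nat.lt_or_ge b π.length with hb' | hb'
      · rw [hval a ha', hval b hb', hpre a b ha' hb', ← hord ⟨a, ha'⟩ ⟨b, hb'⟩]
        omega
      · obtain rfl : b = π.length := by omega
        rw [hval a ha', hval']
        have h1 := hle ⟨a, ha'⟩
        have h2 := hgt ⟨a, ha'⟩
        have h3 := hne ⟨a, ha'⟩
        dsimp only at h1 h2 h3
        omega
      · obtain rfl : a = π.length := by omega
        rw [hval b hb', hval']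
        have h1 := hle ⟨b, hb'⟩
        have h2 := hgt ⟨b, hb'⟩
        have h3 := hne ⟨b, hb'⟩
        dsimp only at h1 h2 h3
        omega
      · obtain rfl : a = π.length := by omega
        obtain rfl : b = π.length := by omega
        simp
end

section
/- Let π be a pattern of length k ≥ 1 and let π' be a pattern of length k+1 such that π' = σx or π' = xσ for some value x and a sequence σ order-isomorphic to π. There is an absolute constant C such that for every n: if π'-PPM_{2n} can be solved by a deterministic single-pass streaming algorithm using s bits of space, then π-PPM_n can be solved by a deterministic single-pass streaming algorithm using at most s + C·log₂ n bits of space; the same holds with π'-SequencePPM_{2n} and π-SequencePPM_n in place of π'-PPM_{2n} and π-PPM_n. -/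
theorem contains_iff_exists_zip {τ π : List ℕ} :
    Contains τ π ↔ ∃ z : List (ℕ × ℕ), (z.map Prod.fst).Sublist τ ∧ z.map Prod.snd = π ∧
      ∀ p ∈ z, ∀ q ∈ z, (p.1 < q.1 ↔ p.2 < q.2) := by
  constructor
  · rintro ⟨f, hf, h⟩
    refine ⟨List.ofFn fun j => (τ.get (f j), π.get j), ?_, ?_, ?_⟩
    · rw [List.sublist_iff_exists_fin_orderEmbedding_get_eq]
      refine ⟨OrderEmbedding.ofStrictMono
        (fun i => f (Fin.cast (by simp) i)) fun i j hij => hf hij, fun i => ?_⟩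
      simp
      rfl
    · rw [List.map_ofFn]
      exact List.ofFn_get π
    · intro p hp q hq
      obtain ⟨i, rfl⟩ := (List.mem_ofFn' _ _).1 hp
      obtain ⟨j, rfl⟩ := (List.mem_ofFn' _ _).1 hq
      exact h i j
  · rintro ⟨z, hs, rfl, h⟩
    obtain ⟨f, hf⟩ := List.sublist_iff_exists_fin_orderEmbedding_get_eq.1 hs
    refine ⟨fun i => f (Fin.cast (by simp) i), fun i j hij => f.strictMono hij, fun i j => ?_⟩
    rw [← hf, ← hf]
    simpa using h _ (List.getElem_mem _) _ (List.getElem_mem _)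

theorem Contains.reverse {τ π : List ℕ} (h : Contains τ π) :
    Contains τ.reverse π.reverse := by
  rw [contains_iff_exists_zip] at h ⊢
  obtain ⟨z, hs, rfl, h⟩ := h
  exact ⟨z.reverse, by simpa using hs, by simp, by simpa using h⟩

theorem contains_reverse_iff {τ π : List ℕ} :
    Contains τ.reverse π.reverse ↔ Contains τ π :=
  ⟨fun h => by simpa using h.reverse, Contains.reverse⟩

theorem OrderIsoSeq.contains_iff {σ π : List ℕ} (h : OrderIsoSeq σ π) (τ : List ℕ) :
    Contains τ σ ↔ Contains τ π := by
  obtain ⟨hl, h⟩ := h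
  have h' : ∀ i j (hi : i < σ.length) (hj : j < σ.length),
      (σ[i] < σ[j] ↔ π[i]'(hl ▸ hi) < π[j]'(hl ▸ hj)) := by
    intro i j hi hj
    have := h i j hi hj
    rwa [List.getD_eq_getElem _ _ hi, List.getD_eq_getElem _ _ hj,
      List.getD_eq_getElem _ _ (hl ▸ hi), List.getD_eq_getElem _ _ (hl ▸ hj)] at this
  constructor
  · rintro ⟨f, hf, hc⟩
    refine ⟨fun i => f (Fin.cast hl.symm i), fun i j hij => hf hij, fun i j => ?_⟩
    rw [hc]
    exact h' _ _ _ _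
  · rintro ⟨f, hf, hc⟩
    refine ⟨fun i => f (Fin.cast hl i), fun i j hij => hf hij, fun i j => ?_⟩
    rw [hc]
    exact (h' _ _ _ _).symm

theorem isPermOf_iff {n : ℕ} {τ : List ℕ} :
    IsPermOf n τ ↔ IsDistinctSeqIn n τ ∧ ∀ v, 1 ≤ v → v ≤ n → v ∈ τ := by
  constructor
  · intro h
    refine ⟨⟨h.nodup_iff.2 List.nodup_range', fun v hv => ?_⟩, fun v h1 h2 => ?_⟩
    · have := h.mem_iff.1 hv
      rw [List.mem_range'_1] at this
      omega
    · rw [h.mem_iff, List.mem_range'_1]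
      omega
  · rintro ⟨⟨hn, hb⟩, hs⟩
    refine (List.perm_ext_iff_of_nodup hn List.nodup_range').2 fun v => ?_
    rw [List.mem_range'_1]
    constructor
    · intro hv
      have := hb v hv
      omega
    · intro hv
      exact hs v (by omega) (by omega)

/-- If the order of the two last entries of the pattern `σ ++ [l] ++ [x]` never occurs in `w`, an
occurrence of the pattern in `τ ++ w` uses at most one entry of `w`. -/
theorem Contains.of_append {τ w σ : List ℕ} {l x : ℕ}
    (hw : w.Pairwise fun p q => ¬(p < q ↔ l < x))
    (h : Contains (τ ++ w) (σ ++ [l] ++ [x])) : Contains τ (σ ++ [l]) := by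
  rw [contains_iff_exists_zip] at h ⊢
  obtain ⟨z, hs, hz, h⟩ := h
  obtain ⟨z₁, z₂, rfl, hz₁, hz₂⟩ := List.map_eq_append_iff.1 hz
  obtain ⟨a, rfl, rfl⟩ := List.map_eq_singleton_iff.1 hz₂
  refine ⟨z₁, ?_, hz₁, fun p hp q hq => h p (by simp [hp]) q (by simp [hq])⟩
  obtain ⟨z₃, z₄, rfl, -, hz₄⟩ := List.map_eq_append_iff.1 hz₁
  obtain ⟨b, rfl, rfl⟩ := List.map_eq_singleton_iff.1 hz₄
  have hab := h b (by simp) a (by simp)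
  obtain ⟨l₁, l₂, hl, h₁, h₂⟩ := List.sublist_append_iff.1 hs
  rcases List.eq_nil_or_concat' l₂ with rfl | ⟨l₃, c, rfl⟩
  · rw [List.append_nil] at hl
    refine List.Sublist.trans ?_ h₁
    rw [← hl]
    simp
  · rw [List.map_append, ← List.append_assoc] at hl
    obtain ⟨hl, hc⟩ := List.append_inj' hl rfl
    rcases List.eq_nil_or_concat' l₃ with rfl | ⟨l₄, d, rfl⟩
    · rw [hl, List.append_nil]
      exact h₁
    · rw [List.map_append, ← List.append_assoc] at hl
      obtain ⟨-, hd⟩ := List.append_inj' hl rfl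
      simp only [List.map_cons, List.map_nil, List.cons.injEq, and_true] at hc hd
      subst hc hd
      have hsub : [b.1, a.1].Sublist w := by
        refine List.Sublist.trans ?_ h₂
        simp
      have := hw.sublist hsub
      simp only [List.pairwise_pair] at this
      exact absurd hab this

theorem Contains.of_map {f : ℕ → ℕ} (hf : StrictMono f) {τ σ : List ℕ}
    (h : Contains (τ.map f) σ) : Contains τ σ := by
  obtain ⟨e, he, h⟩ := h
  refine ⟨fun i => Fin.cast (by simp) (e i), fun i j hij => he hij, fun i j => ?_⟩
  rw [← h]
  simp [hf.lt_iff_lt]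

/-- Doubling a sequence and appending a monotone sequence of the remaining values turns the
search for `σ` into the search for `σ ++ [x]`. -/
theorem exists_append_reduction {σ : List ℕ} {x : ℕ} (hσ : σ ≠ [])
    (hp : (σ ++ [x]).Perm (List.range' 1 (σ.length + 1))) (n : ℕ) :
    ∃ (f : ℕ → ℕ) (w : List ℕ), ∀ τ, IsDistinctSeqIn n τ →
      (Contains (τ.map f ++ w) (σ ++ [x]) ↔ Contains τ σ) ∧
      IsDistinctSeqIn (2 * n) (τ.map f ++ w) ∧
      (IsPermOf n τ → IsPermOf (2 * n) (τ.map f ++ w)) := by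
  have hne : ∀ s ∈ σ, s ≠ x := by
    have := hp.nodup_iff.2 List.nodup_range'
    rw [List.nodup_append] at this
    exact fun s hs => this.2.2 s hs x (by simp)
  have hmem : ∀ s, s ∈ σ ++ [x] ↔ 1 ≤ s ∧ s ≤ σ.length + 1 := fun s => by
    rw [hp.mem_iff, List.mem_range'_1]
    omega
  have hlen := List.length_pos_iff.2 hσ
  obtain ⟨d, y, hy, hd⟩ : ∃ d y, y ∈ σ ∧
      ((d = 1 ∧ x = y + 1) ∨ (d = 0 ∧ y = x + 1)) := by
    have hx := (hmem x).1 (by simp)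
    by_cases h : 2 ≤ x
    · refine ⟨1, x - 1, ?_, by omega⟩
      have := (hmem (x - 1)).2 (by omega)
      simp only [List.mem_append, List.mem_singleton] at this
      exact this.resolve_right (by omega)
    · refine ⟨0, x + 1, ?_, by omega⟩
      have := (hmem (x + 1)).2 (by omega)
      simp only [List.mem_append, List.mem_singleton] at this
      exact this.resolve_right (by omega)
  obtain ⟨σ', l, rfl⟩ := (List.eq_nil_or_concat' σ).resolve_left hσ
  have hf : StrictMono fun v => 2 * v - d := fun u v huv => by
    dsimp only
    omega
  have hinc : ((List.range' 1 n).map fun v => 2 * v - (1 - d)).Pairwise (· < ·) := by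
    rw [List.pairwise_map]
    refine (List.pairwise_lt_range' (s := 1) (n := n)).imp fun huv => ?_
    omega
  obtain ⟨w, hw, hwn, hwmem⟩ : ∃ w : List ℕ, w.Pairwise (fun p q => ¬(p < q ↔ l < x)) ∧
      w.Nodup ∧ ∀ a, a ∈ w ↔ ∃ v, (1 ≤ v ∧ v ≤ n) ∧ 2 * v - (1 - d) = a := by
    have hmem' : ∀ a, a ∈ (List.range' 1 n).map (fun v => 2 * v - (1 - d)) ↔
        ∃ v, (1 ≤ v ∧ v ≤ n) ∧ 2 * v - (1 - d) = a := fun a => by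
      simp only [List.mem_map, List.mem_range'_1, add_comm 1 n, Nat.lt_succ_iff]
    by_cases hlx : l < x
    · refine ⟨_, List.pairwise_reverse.2 (hinc.imp fun h => ?_),
        List.nodup_reverse.2 (hinc.imp fun h => h.ne), fun a => List.mem_reverse.trans (hmem' a)⟩
      omega
    · refine ⟨_, hinc.imp fun h => ?_, hinc.imp fun h => h.ne, hmem'⟩
      omega
  refine ⟨fun v => 2 * v - d, w, fun τ hτ => ?_⟩
  have hdist : IsDistinctSeqIn (2 * n) (τ.map (fun v => 2 * v - d) ++ w) := by
    refine ⟨List.nodup_append.2 ⟨hτ.1.map hf.injective, hwn, ?_⟩, ?_⟩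
    · intro a ha b hb
      obtain ⟨u, hu, rfl⟩ := List.mem_map.1 ha
      obtain ⟨v, hv, rfl⟩ := (hwmem b).1 hb
      have := hτ.2 u hu
      omega
    · intro a ha
      rcases List.mem_append.1 ha with ha | ha
      · obtain ⟨u, hu, rfl⟩ := List.mem_map.1 ha
        have := hτ.2 u hu
        omega
      · obtain ⟨v, hv, rfl⟩ := (hwmem a).1 ha
        omega
  refine ⟨⟨fun h => (h.of_append hw).of_map hf, fun h => ?_⟩, hdist, fun h => ?_⟩
  · rw [contains_iff_exists_zip] at h ⊢
    obtain ⟨z, hs, hz, h⟩ := h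
    obtain ⟨⟨v, y'⟩, hvz, rfl⟩ := List.mem_map.1 (hz ▸ hy)
    have hv := hτ.2 v (hs.subset (List.mem_map_of_mem hvz))
    refine ⟨z.map (fun p => (2 * p.1 - d, p.2)) ++ [(2 * v - (1 - d), x)], ?_, ?_, ?_⟩
    · rw [List.map_append]
      refine List.Sublist.append ?_ (List.singleton_sublist.2 ((hwmem _).2 ⟨v, hv, rfl⟩))
      simpa [Function.comp_def] using hs.map fun v => 2 * v - d
    · rw [List.map_append, List.map_map]
      exact congrArg (· ++ [x]) hz
    · have key : ∀ p ∈ z, (2 * p.1 - d < 2 * v - (1 - d) ↔ p.2 < x) ∧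
          (2 * v - (1 - d) < 2 * p.1 - d ↔ x < p.2) := by
        intro p hpz
        have h₁ := h p hpz _ hvz
        have h₂ := h _ hvz p hpz
        have h₃ := hne p.2 (hz ▸ List.mem_map_of_mem hpz)
        have h₄ := hτ.2 p.1 (hs.subset (List.mem_map_of_mem hpz))
        simp only at h₁ h₂ hd
        omega
      intro p hp q hq
      simp only [List.mem_append, List.mem_map, List.mem_singleton] at hp hq
      rcases hp with ⟨p, hp, rfl⟩ | rfl <;> rcases hq with ⟨q, hq, rfl⟩ | rfl
      · exact hf.lt_iff_lt.trans (h p hp q hq)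
      · exact (key p hp).1
      · exact (key q hq).2
      · simp
  · refine isPermOf_iff.2 ⟨hdist, fun a h1 h2 => ?_⟩
    have hτmem := (isPermOf_iff.1 h).2
    rw [List.mem_append]
    by_cases hpar : a % 2 = d
    · left
      exact List.mem_map.2 ⟨(a + 1) / 2, hτmem _ (by omega) (by omega), by omega⟩
    · right
      exact (hwmem a).2 ⟨(a + 1) / 2, by omega, by omega⟩

/-- The algorithm that runs `A` on `u ++ τ.map f ++ w` when given the input `τ`. -/
def StreamAlg.frame {Q : Type} (A : StreamAlg Q) (f : ℕ → ℕ) (u w : List ℕ) :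
    StreamAlg Q where
  q0 := A.run u
  F := {q | w.foldl A.t q ∈ A.F}
  t q v := A.t q (f v)

theorem StreamAlg.frame_accepts {Q : Type} (A : StreamAlg Q) (f : ℕ → ℕ) (u w τ : List ℕ) :
    (A.frame f u w).Accepts τ ↔ A.Accepts (u ++ τ.map f ++ w) := by
  simp [Accepts, run, frame, List.foldl_append, List.foldl_map]

theorem exists_frame_reduction {π π' σ : List ℕ} {x : ℕ} (hπ' : IsPattern π')
    (hπ : 1 ≤ π.length) (h : π' = σ ++ [x] ∨ π' = x :: σ) (hσ : OrderIsoSeq σ π) (n : ℕ) :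
    ∃ (f : ℕ → ℕ) (u w : List ℕ), ∀ τ, IsDistinctSeqIn n τ →
      (Contains (u ++ τ.map f ++ w) π' ↔ Contains τ π) ∧
      IsDistinctSeqIn (2 * n) (u ++ τ.map f ++ w) ∧
      (IsPermOf n τ → IsPermOf (2 * n) (u ++ τ.map f ++ w)) := by
  have hne : σ ≠ [] := List.length_pos_iff.1 (hσ.1 ▸ hπ)
  rcases h with rfl | rfl
  · obtain ⟨f, w, H⟩ := exists_append_reduction hne (by simpa [IsPattern] using hπ') n
    refine ⟨f, [], w, fun τ hτ => ?_⟩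
    rw [List.nil_append, ← hσ.contains_iff]
    exact H τ hτ
  · have hp : (σ.reverse ++ [x]).Perm (List.range' 1 (σ.reverse.length + 1)) := by
      rw [← List.reverse_cons, List.length_reverse]
      exact (List.reverse_perm _).trans hπ'
    obtain ⟨f, w, H⟩ := exists_append_reduction (by simpa using hne) hp n
    refine ⟨f, w.reverse, [], fun τ hτ => ?_⟩
    have hrev : w.reverse ++ τ.map f ++ [] = (τ.reverse.map f ++ w).reverse := by simp
    obtain ⟨h₁, h₂, h₃⟩ := H τ.reverse
      ⟨List.nodup_reverse.2 hτ.1, fun v hv => hτ.2 v (List.mem_reverse.1 hv)⟩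
    rw [hrev, ← hσ.contains_iff]
    refine ⟨?_, ⟨List.nodup_reverse.2 h₂.1, fun v hv => h₂.2 v (List.mem_reverse.1 hv)⟩,
      fun h => (List.reverse_perm _).trans (h₃ ((List.reverse_perm _).trans h))⟩
    rw [← contains_reverse_iff, List.reverse_reverse, List.reverse_cons, h₁,
      contains_reverse_iff]

/-- Let `π` be a pattern of length `k ≥ 1` and `π'` a pattern of length `k+1`
with `π' = σx` or `π' = xσ`, `σ` order-isomorphic to `π`. There is an absolute constant `C`
such that for every `n`: if `π'`-PPM_{2n} is solvable with `s` bits of space, then `π`-PPM_n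
is solvable with at most `s + C·log₂ n` bits of space; the same holds for SequencePPM. -/
theorem stmt8 :
    ∃ C : ℕ,
      ∀ (π π' σ : List ℕ) (x : ℕ),
        IsPattern π → IsPattern π' → 1 ≤ π.length → π'.length = π.length + 1 →
        (π' = σ ++ [x] ∨ π' = x :: σ) → OrderIsoSeq σ π →
        ∀ n s : ℕ,
          ((∃ (Q : Type) (inst : Fintype Q) (A : StreamAlg Q),
              Nat.clog 2 (@Fintype.card Q inst) ≤ s ∧ SolvesPPM A (2 * n) π') →
            (∃ (Q : Type) (inst : Fintype Q) (A : StreamAlg Q),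
              Nat.clog 2 (@Fintype.card Q inst) ≤ s + C * Nat.clog 2 n ∧ SolvesPPM A n π)) ∧
          ((∃ (Q : Type) (inst : Fintype Q) (A : StreamAlg Q),
              Nat.clog 2 (@Fintype.card Q inst) ≤ s ∧ SolvesSeqPPM A (2 * n) π') →
            (∃ (Q : Type) (inst : Fintype Q) (A : StreamAlg Q),
              Nat.clog 2 (@Fintype.card Q inst) ≤ s + C * Nat.clog 2 n ∧
                SolvesSeqPPM A n π)) := by
  refine ⟨0, fun π π' σ x _ hπ' hπ _ h hσ n s => ?_⟩
  obtain ⟨f, u, w, H⟩ := exists_frame_reduction hπ' hπ h hσ n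
  constructor
  · rintro ⟨Q, inst, A, hs, hA⟩
    refine ⟨Q, inst, A.frame f u w, by omega, fun τ hτ => ?_⟩
    obtain ⟨h₁, -, h₃⟩ := H τ (isPermOf_iff.1 hτ).1
    rw [A.frame_accepts, hA _ (h₃ hτ), h₁]
  · rintro ⟨Q, inst, A, hs, hA⟩
    refine ⟨Q, inst, A.frame f u w, by omega, fun τ hτ => ?_⟩
    obtain ⟨h₁, h₂, -⟩ := H τ hτ
    rw [A.frame_accepts, hA _ h₂, h₁]
end

section
/- For every non-monotone pattern π there exist constants c > 0 and N such that for all n ≥ N, every deterministic single-pass streaming algorithm that solves π-SequencePPM_n uses at least c·n bits of space, i.e., has at least 2^{c·n} states. -/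
/-- Two pairs of numbers whose first and second components compare in the same way. -/
def SameOrder (p q : ℕ × ℕ) : Prop :=
  (p.1 < q.1 ↔ p.2 < q.2) ∧ (q.1 < p.1 ↔ q.2 < p.2)

/-- Containment of a pattern, witnessed by the list of pairs
(entry of the sequence, matching entry of the pattern). -/
theorem contains_iff {τ π : List ℕ} :
    Contains τ π ↔ ∃ z : List (ℕ × ℕ),
      z.map Prod.snd = π ∧ (z.map Prod.fst).Sublist τ ∧ z.Pairwise SameOrder := by
  constructor
  · rintro ⟨f, hf, h⟩
    refine ⟨List.ofFn fun j => (τ.get (f j), π.get j), ?_, ?_, ?_⟩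
    · rw [List.map_ofFn]
      exact List.ofFn_get π
    · rw [List.map_ofFn, List.sublist_iff_exists_fin_orderEmbedding_get_eq]
      refine ⟨(Fin.castOrderIso (by simp)).toOrderEmbedding.trans
        (OrderEmbedding.ofStrictMono f hf), ?_⟩
      intro i
      simp
      rfl
    · rw [List.pairwise_ofFn]
      exact fun i j _ => ⟨h i j, h j i⟩
  · rintro ⟨z, rfl, hs, hp⟩
    obtain ⟨f, hf⟩ := List.sublist_iff_exists_fin_orderEmbedding_get_eq.1 hs
    have hlen : (z.map Prod.snd).length = (z.map Prod.fst).length := by simp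
    refine ⟨fun j => f (Fin.cast hlen j),
      fun i j hij => f.strictMono (by simpa using hij), fun j l => ?_⟩
    rw [← hf, ← hf]
    rw [List.pairwise_iff_getElem] at hp
    have hj : j.1 < z.length := by simpa using j.2
    have hl : l.1 < z.length := by simpa using l.2
    simp only [List.get_eq_getElem, List.getElem_map, Fin.val_cast]
    rcases lt_trichotomy j.1 l.1 with h | h | h
    · exact (hp _ _ hj hl h).1
    · simp [h]
    · exact (hp _ _ hl hj h).2

theorem Contains.map {τ π : List ℕ} (g h : ℕ → ℕ)
    (hgh : ∀ x ∈ τ, ∀ y ∈ τ, ∀ p ∈ π, ∀ q ∈ π,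
      SameOrder (x, p) (y, q) → SameOrder (g x, h p) (g y, h q))
    (hc : Contains τ π) : Contains (τ.map g) (π.map h) := by
  obtain ⟨z, rfl, hs, hp⟩ := contains_iff.1 hc
  refine contains_iff.2 ⟨z.map (Prod.map g h), by simp, ?_, ?_⟩
  · have := hs.map g
    rwa [List.map_map] at this ⊢
  · rw [List.pairwise_map]
    refine hp.imp_of_mem fun {a b} ha hb hab => ?_
    exact hgh _ (hs.subset (List.mem_map_of_mem ha)) _ (hs.subset (List.mem_map_of_mem hb))
      _ (List.mem_map_of_mem ha) _ (List.mem_map_of_mem hb) hab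

theorem contains_map_add_one_iff {τ π : List ℕ} :
    Contains (τ.map (· + 1)) π ↔ Contains τ π := by
  constructor
  · intro h
    have := h.map (· - 1) id (by
      simp only [List.mem_map]
      rintro _ ⟨x, -, rfl⟩ _ ⟨y, -, rfl⟩ p - q -
      simp [SameOrder])
    simpa [Function.comp_def] using this
  · intro h
    have := h.map (· + 1) id (by simp [SameOrder])
    simpa using this

theorem map_sub_map_sub {M : ℕ} {τ : List ℕ} (h : ∀ x ∈ τ, x ≤ M) :
    (τ.map (M - ·)).map (M - ·) = τ := by
  rw [List.map_map]
  conv_rhs => rw [← List.map_id τ]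
  refine List.map_congr_left fun x hx => ?_
  have := h x hx
  simp only [Function.comp_apply, id]
  omega

theorem Contains.compl {τ π : List ℕ} {M K : ℕ} (hτ : ∀ x ∈ τ, x ≤ M) (hπ : ∀ x ∈ π, x ≤ K)
    (h : Contains τ π) : Contains (τ.map (M - ·)) (π.map (K - ·)) := by
  refine h.map _ _ fun x hx y hy p hp q hq hxy => ?_
  have := hτ x hx
  have := hτ y hy
  have := hπ p hp
  have := hπ q hq
  simp only [SameOrder] at *
  omega

theorem contains_cons_iff_of_lt {c a : ℕ} {τ t : List ℕ} (hc : ∀ x ∈ τ, c < x)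
    (ha : ∀ x ∈ t, a < x) : Contains (c :: τ) (a :: t) ↔ Contains τ t := by
  rw [contains_iff, contains_iff]
  constructor
  · rintro ⟨z, hz, hs, hp⟩
    obtain ⟨w, z, rfl, hw, rfl⟩ := List.map_eq_cons_iff.1 hz
    exact ⟨z, rfl, hs.tail, hp.of_cons⟩
  · rintro ⟨z, rfl, hs, hp⟩
    refine ⟨(c, a) :: z, rfl, hs.cons_cons c, List.pairwise_cons.2 ⟨fun w hw => ?_, hp⟩⟩
    have h1 := hc _ (hs.subset (List.mem_map_of_mem hw))
    have h2 := ha _ (List.mem_map_of_mem hw)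
    simp only [SameOrder]
    omega

/-- Arbitrary subsets `S` of `{0,…,m-1}` can be encoded as prefixes, over an alphabet of size
linear in `m`, such that membership in `S` is decided by pattern containment after appending
a suffix depending only on the queried element. -/
def EncodesSubsets (π : List ℕ) : Prop :=
  ∃ C : ℕ, 0 < C ∧ ∀ m : ℕ, ∃ (p : Finset ℕ → List ℕ) (s : ℕ → List ℕ),
    ∀ (S : Finset ℕ), ∀ i < m, IsDistinctSeqIn (C * (m + 1)) (p S ++ s i) ∧
      (Contains (p S ++ s i) π ↔ i ∈ S)

theorem EncodesSubsets.compl {π : List ℕ} {K : ℕ} (hK : ∀ x ∈ π, x ≤ K)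
    (h : EncodesSubsets (π.map (K - ·))) : EncodesSubsets π := by
  obtain ⟨C, hC, h⟩ := h
  refine ⟨C, hC, fun m => ?_⟩
  obtain ⟨p, s, h⟩ := h m
  refine ⟨fun S => (p S).map (C * (m + 1) + 1 - ·), fun i => (s i).map (C * (m + 1) + 1 - ·),
    fun S i hi => ?_⟩
  obtain ⟨⟨hn, hb⟩, hc⟩ := h S i hi
  have hb' : ∀ x ∈ p S ++ s i, x ≤ C * (m + 1) + 1 := fun x hx => (hb x hx).2.trans (by simp)
  rw [← List.map_append, ← hc]
  refine ⟨⟨?_, ?_⟩, ?_, ?_⟩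
  · refine (List.nodup_map_iff_inj_on hn).2 fun x hx y hy hxy => ?_
    have := hb x hx
    have := hb y hy
    omega
  · simp only [List.mem_map]
    rintro _ ⟨x, hx, rfl⟩
    have := hb x hx
    omega
  · intro h
    have := h.compl (M := C * (m + 1) + 1) (K := K)
      (by simp only [List.mem_map]; rintro _ ⟨x, -, rfl⟩; exact Nat.sub_le _ _) hK
    rwa [map_sub_map_sub hb'] at this
  · intro h
    have := h.compl (K := K) hb' (by simp)
    rwa [map_sub_map_sub hK] at this

theorem EncodesSubsets.cons {a : ℕ} {t : List ℕ} (ha : ∀ x ∈ t, a < x) (h : EncodesSubsets t) :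
    EncodesSubsets (a :: t) := by
  obtain ⟨C, hC, h⟩ := h
  refine ⟨C + 1, by omega, fun m => ?_⟩
  obtain ⟨p, s, h⟩ := h m
  refine ⟨fun S => 1 :: (p S).map (· + 1), fun i => (s i).map (· + 1), fun S i hi => ?_⟩
  obtain ⟨⟨hn, hb⟩, hc⟩ := h S i hi
  rw [List.cons_append, ← List.map_append, ← hc]
  have hgt : ∀ x ∈ (p S ++ s i).map (· + 1), 1 < x := by
    simp only [List.mem_map]
    rintro _ ⟨x, hx, rfl⟩
    have := hb x hx
    omega
  refine ⟨⟨List.nodup_cons.2 ⟨fun h1 => lt_irrefl _ (hgt 1 h1),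
    hn.map (add_left_injective 1)⟩, ?_⟩, ?_⟩
  · simp only [List.mem_cons, List.mem_map]
    rintro _ (rfl | ⟨x, hx, rfl⟩)
    · exact ⟨le_rfl, Nat.mul_pos (by omega) (by omega)⟩
    · have := hb x hx
      refine ⟨by omega, ?_⟩
      rw [add_mul]
      omega
  · rw [contains_cons_iff_of_lt hgt ha, contains_map_add_one_iff]

theorem block_le {K j m x : ℕ} (hj : j < m) (hx : x < K) : 1 + K * j + x ≤ K * (m + 1) := by
  have : K * (j + 1) ≤ K * m := Nat.mul_le_mul_left K hj
  rw [mul_add] at *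
  omega

theorem block_index_le {K i j x y : ℕ} (hy : y < K) (h : 1 + K * i + x ≤ 1 + K * j + y) :
    i ≤ j := by
  by_contra! hlt
  have : K * (j + 1) ≤ K * i := Nat.mul_le_mul_left K hlt
  rw [mul_add] at this
  omega

theorem block_inj {K i j x y : ℕ} (hx : x < K) (hy : y < K)
    (h : 1 + K * i + x = 1 + K * j + y) : i = j ∧ x = y := by
  obtain rfl : i = j := le_antisymm (block_index_le hy h.le) (block_index_le hx h.ge)
  exact ⟨rfl, by omega⟩

theorem exists_bound (π : List ℕ) : ∃ K, 0 < K ∧ ∀ x ∈ π, x < K :=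
  ⟨π.sum + 1, by omega, fun _ hx => Nat.lt_succ_of_le (List.le_sum_of_mem hx)⟩

/-- A block of a sequence carrying a translate of the pattern contains the pattern. -/
theorem contains_of_sublist_map_add {τ π : List ℕ} (c : ℕ)
    (h : (π.map (c + ·)).Sublist τ) : Contains τ π := by
  refine contains_iff.2 ⟨π.map fun x => (c + x, x), ?_, ?_, ?_⟩
  · simp [Function.comp_def]
  · rwa [List.map_map]
  rw [List.pairwise_map]
  refine List.pairwise_of_forall fun x y => ?_
  simp [SameOrder]

/-- Split a witness of containment in a concatenation. -/
theorem exists_append_of_contains {p s π : List ℕ} (h : Contains (p ++ s) π) :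
    ∃ z₁ z₂ : List (ℕ × ℕ), (z₁ ++ z₂).map Prod.snd = π ∧ (z₁.map Prod.fst).Sublist p ∧
      (z₂.map Prod.fst).Sublist s ∧ (z₁ ++ z₂).Pairwise SameOrder := by
  obtain ⟨z, rfl, hs, hp⟩ := contains_iff.1 h
  obtain ⟨l₁, l₂, hl, h₁, h₂⟩ := List.sublist_append_iff.1 hs
  obtain ⟨z₁, z₂, rfl, rfl, rfl⟩ := List.map_eq_append_iff.1 hl
  exact ⟨z₁, z₂, rfl, h₁, h₂, hp⟩

/-- If the part of a witness mapped to the suffix has the length of the suffix, it uses the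
entries in the same order. -/
theorem mem_of_map_fst_sublist {z : List (ℕ × ℕ)} {t : List ℕ} {c : ℕ}
    (hz : z.map Prod.snd = t) (hs : (z.map Prod.fst).Sublist (t.map (c + ·))) :
    ∀ x ∈ t, (c + x, x) ∈ z := by
  have he := hs.eq_of_length (by rw [← hz]; simp)
  have : z = t.map fun x => (c + x, x) := by
    exact (List.zip_of_prod he hz).trans List.map_prod_right_eq_zip.symm
  intro x hx
  rw [this]
  exact List.mem_map_of_mem (f := fun x => (c + x, x)) hx

/-- Patterns whose first entry is neither their minimum nor their maximum. -/
theorem encodesSubsets_of_mid {a b x y : ℕ} {t : List ℕ} (hn : (a :: b :: t).Nodup)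
    (hx : x ∈ b :: t) (hxa : x < a) (hy : y ∈ b :: t) (hay : a < y) :
    EncodesSubsets (a :: b :: t) := by
  obtain ⟨K, hK, hb⟩ := exists_bound (a :: b :: t)
  have haK : a < K := hb a (by simp)
  have htK : ∀ w ∈ b :: t, w < K := fun w hw => hb w (List.mem_cons_of_mem _ hw)
  obtain ⟨hat, htn⟩ := List.nodup_cons.1 hn
  refine ⟨K, hK, fun m => ?_⟩
  obtain ⟨L, hLm, hLn, hL⟩ : ∃ L : List ℕ, (∀ j, j ∈ L ↔ j < m) ∧ L.Nodup ∧
      L.Pairwise fun i j => ¬ SameOrder (1 + K * i + a, a) (1 + K * j + a, b) := by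
    have hmono : ∀ {i j}, i < j → K * i < K * j := fun h => Nat.mul_lt_mul_of_pos_left h hK
    rcases lt_or_gt_of_ne (show a ≠ b by rintro rfl; simp at hat) with hab | hab
    · refine ⟨(List.range m).reverse, by simp, by simpa using List.nodup_range, ?_⟩
      rw [List.pairwise_reverse]
      refine List.pairwise_lt_range.imp fun {i j} h => ?_
      have := hmono h
      simp only [SameOrder]
      omega
    · refine ⟨List.range m, by simp, List.nodup_range, ?_⟩
      refine List.pairwise_lt_range.imp fun {i j} h => ?_
      have := hmono h
      simp only [SameOrder]
      omega
  refine ⟨fun S => (L.filter (· ∈ S)).map (1 + K * · + a),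
    fun i => (b :: t).map (1 + K * i + ·), fun S i hi => ⟨⟨?_, ?_⟩, ?_, ?_⟩⟩
  · refine List.nodup_append'.2 ⟨?_, ?_, ?_⟩
    · refine (hLn.filter _).map fun j j' h => ?_
      exact (block_inj haK haK h).1
    · exact htn.map (add_right_injective _)
    · intro w hw hw'
      obtain ⟨j, -, rfl⟩ := List.mem_map.1 hw
      obtain ⟨u, hu, he⟩ := List.mem_map.1 hw'
      exact hat ((block_inj (htK u hu) haK he).2 ▸ hu)
  · intro w hw
    rcases List.mem_append.1 hw with hw | hw
    · obtain ⟨j, hj, rfl⟩ := List.mem_map.1 hw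
      exact ⟨by omega, block_le ((hLm j).1 (List.mem_filter.1 hj).1) haK⟩
    · obtain ⟨u, hu, rfl⟩ := List.mem_map.1 hw
      exact ⟨by omega, block_le hi (htK u hu)⟩
  · intro h
    obtain ⟨z₁, z₂, hz, h₁, h₂, hp⟩ := exists_append_of_contains h
    rcases z₁ with _ | ⟨⟨u, u'⟩, _ | ⟨⟨v, v'⟩, z⟩⟩
    · have hl := h₂.length_le
      have hl' := congrArg List.length hz
      simp at hl hl'
      omega
    · simp only [List.cons_append, List.nil_append, List.map_cons] at hz
      obtain ⟨rfl, hz'⟩ := List.cons_eq_cons.1 hz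
      have hmem := mem_of_map_fst_sublist hz' h₂
      obtain ⟨j, hj, rfl⟩ := List.mem_map.1 (h₁.subset (by simp : u ∈ _))
      have hso := (List.pairwise_cons.1 hp).1
      have h1 := (hso _ (hmem x hx)).2.2 hxa
      have h2 := (hso _ (hmem y hy)).1.2 hay
      obtain rfl : i = j := le_antisymm (block_index_le haK h1.le) (block_index_le (htK y hy) h2.le)
      simpa using (List.mem_filter.1 hj).2
    · exfalso
      simp only [List.cons_append, List.map_cons] at hz
      simp only [List.cons_eq_cons] at hz
      obtain ⟨rfl, rfl, -⟩ := hz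
      have h3 : ((L.filter (· ∈ S)).map (1 + K * · + u')).Pairwise
          fun c d => ¬ SameOrder (c, u') (d, v') := by
        rw [List.pairwise_map]
        exact hL.filter _
      have h4 := h3.sublist h₁
      simp only [List.map_cons, List.pairwise_cons] at h4
      simp only [List.cons_append, List.pairwise_cons] at hp
      exact h4.1 v (by simp) (hp.1 _ (by simp))
  · intro hiS
    refine contains_of_sublist_map_add (1 + K * i) ?_
    have : [1 + K * i + a].Sublist ((L.filter (· ∈ S)).map (1 + K * · + a)) := by
      rw [List.singleton_sublist]
      exact List.mem_map_of_mem (f := (1 + K * · + a))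
        (List.mem_filter.2 ⟨(hLm i).2 hi, by simpa using hiS⟩)
    exact this.append (List.Sublist.refl _)

/-- Patterns consisting of their minimum followed by a decreasing sequence. -/
theorem encodesSubsets_of_min_cons_decreasing {a b x : ℕ} {t : List ℕ}
    (ha : ∀ w ∈ b :: x :: t, a < w) (hd : (b :: x :: t).Pairwise (· > ·)) :
    EncodesSubsets (a :: b :: x :: t) := by
  obtain ⟨K, hK, hbd⟩ := exists_bound (a :: b :: x :: t)
  have haK : a < K := hbd a (by simp)
  have hbK : b < K := hbd b (by simp)
  have hab : a < b := ha b (by simp)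
  have htK : ∀ w ∈ x :: t, w < K := fun w hw =>
    hbd w (List.mem_cons_of_mem _ (List.mem_cons_of_mem _ hw))
  have hat : ∀ w ∈ x :: t, a < w := fun w hw => ha w (List.mem_cons_of_mem _ hw)
  have htb : ∀ w ∈ x :: t, w < b := (List.pairwise_cons.1 hd).1
  have hbx : x < b := htb x (by simp)
  have hax : a < x := hat x (by simp)
  refine ⟨K, hK, fun m => ?_⟩
  set P : Finset ℕ → List ℕ := fun S =>
    ((List.range m).reverse.filter (· ∈ S)).flatMap fun j => [1 + K * j + a, 1 + K * j + b] with hP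
  have hmemP : ∀ {S w}, w ∈ P S → ∃ j < m, j ∈ S ∧ (w = 1 + K * j + a ∨ w = 1 + K * j + b) := by
    intro S w hw
    simpa [hP, and_assoc] using hw
  have hrange : ∀ S : Finset ℕ, ((List.range m).reverse.filter (· ∈ S)).Pairwise (· > ·) := by
    intro S
    refine List.Pairwise.filter _ ?_
    rw [List.pairwise_reverse]
    exact List.pairwise_lt_range
  have hpair : ∀ S, (P S).Pairwise fun u v => u ≠ v ∧
      (u < v → ∃ j ∈ S, u = 1 + K * j + a ∧ v = 1 + K * j + b) := by
    intro S
    refine List.pairwise_flatMap.2 ⟨fun j hj => ?_, (hrange S).imp fun {i j} hij u hu v hv => ?_⟩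
    · have : j ∈ S := by simpa using (List.mem_filter.1 hj).2
      simp only [List.pairwise_cons, List.mem_singleton, forall_eq, List.not_mem_nil,
        false_imp_iff, implies_true, List.Pairwise.nil, and_true]
      exact ⟨by omega, fun _ => ⟨j, this, rfl, rfl⟩⟩
    · have : K * (j + 1) ≤ K * i := Nat.mul_le_mul_left K hij
      rw [mul_add] at this
      simp only [List.mem_cons, List.not_mem_nil, or_false] at hu hv
      have hvu : v < u := by omega
      exact ⟨hvu.ne', fun h => absurd h hvu.not_gt⟩
  refine ⟨P, fun i => (x :: t).map (1 + K * i + ·), fun S i hi => ⟨⟨?_, ?_⟩, ?_, ?_⟩⟩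
  · refine List.nodup_append'.2 ⟨(hpair S).imp fun h => h.1, ?_, ?_⟩
    · refine List.Nodup.map (add_right_injective _) ?_
      exact (List.pairwise_cons.1 hd).2.imp fun h => ne_of_gt h
    · intro w hw hw'
      obtain ⟨j, -, -, hj⟩ := hmemP hw
      obtain ⟨u, hu, rfl⟩ := List.mem_map.1 hw'
      rcases hj with hj | hj
      · exact (hat u hu).ne' (block_inj (htK u hu) haK hj).2
      · exact (htb u hu).ne (block_inj (htK u hu) hbK hj).2
  · intro w hw
    rcases List.mem_append.1 hw with hw | hw
    · obtain ⟨j, hj, -, rfl | rfl⟩ := hmemP hw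
      · exact ⟨by omega, block_le hj haK⟩
      · exact ⟨by omega, block_le hj hbK⟩
    · obtain ⟨u, hu, rfl⟩ := List.mem_map.1 hw
      exact ⟨by omega, block_le hi (htK u hu)⟩
  · intro h
    obtain ⟨z₁, z₂, hz, h₁, h₂, hp⟩ := exists_append_of_contains h
    have h4 := (hpair S).sublist h₁
    have hl := h₂.length_le
    have hl' := congrArg List.length hz
    rcases z₁ with _ | ⟨⟨u, u'⟩, _ | ⟨⟨v, v'⟩, _ | ⟨⟨w, w'⟩, z⟩⟩⟩
    · simp at hl hl'
      omega
    · simp at hl hl'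
      omega
    · simp only [List.cons_append, List.nil_append, List.map_cons] at hz
      obtain ⟨rfl, hz'⟩ := List.cons_eq_cons.1 hz
      obtain ⟨rfl, hz''⟩ := List.cons_eq_cons.1 hz'
      have hmem := mem_of_map_fst_sublist hz'' h₂ x (by simp)
      simp only [List.cons_append, List.nil_append, List.pairwise_cons] at hp
      have huv := (hp.1 (v, v') (by simp)).1.2 hab
      have h1 := (hp.1 _ (List.mem_cons_of_mem _ hmem)).1.2 hax
      have h2 := (hp.2.1 _ hmem).2.2 hbx
      simp only [List.map_cons, List.pairwise_cons] at h4
      obtain ⟨j, hj, rfl, rfl⟩ := (h4.1 v (by simp)).2 huv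
      obtain rfl : i = j := le_antisymm (block_index_le hbK h2.le)
        (block_index_le (htK x (by simp)) h1.le)
      exact hj
    · exfalso
      simp only [List.cons_append, List.map_cons] at hz
      simp only [List.cons_eq_cons] at hz
      obtain ⟨rfl, rfl, rfl, -⟩ := hz
      simp only [List.cons_append, List.pairwise_cons] at hp
      have huv := (hp.1 (v, v') (by simp)).1.2 hab
      have huw := (hp.1 (w, w') (by simp)).1.2 hax
      have hwv := (hp.2.1 (w, w') (by simp)).2.2 hbx
      simp only [List.map_cons, List.pairwise_cons] at h4
      obtain ⟨j, -, hj, hj'⟩ := (h4.1 v (by simp)).2 huv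
      obtain ⟨k, -, hk, hk'⟩ := (h4.1 w (by simp)).2 huw
      simp only at *
      omega
  · intro hiS
    refine contains_of_sublist_map_add (1 + K * i) ?_
    have : [1 + K * i + a, 1 + K * i + b].Sublist (P S) := by
      refine List.sublist_flatten_of_mem ?_
      refine List.mem_map_of_mem (f := fun j => [1 + K * j + a, 1 + K * j + b]) ?_
      simpa using ⟨hi, hiS⟩
    exact this.append (List.Sublist.refl _)

theorem encodesSubsets_of_min_cons {a : ℕ} {t : List ℕ} (ha : ∀ x ∈ t, a < x)
    (hi : ¬ (a :: t).Pairwise (· < ·))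
    (ih : ¬ t.Pairwise (· < ·) → ¬ t.Pairwise (· > ·) → EncodesSubsets t) :
    EncodesSubsets (a :: t) := by
  have hti : ¬ t.Pairwise (· < ·) := fun h => hi (List.pairwise_cons.2 ⟨ha, h⟩)
  by_cases htd : t.Pairwise (· > ·)
  · rcases t with _ | ⟨b, _ | ⟨x, t⟩⟩
    · simp at hti
    · simp at hti
    · exact encodesSubsets_of_min_cons_decreasing ha htd
  · exact (ih hti htd).cons ha

theorem encodesSubsets_of_nonmonotone (k : ℕ) : ∀ π : List ℕ, π.length = k → π.Nodup →
    ¬ π.Pairwise (· < ·) → ¬ π.Pairwise (· > ·) → EncodesSubsets π := by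
  induction k with
  | zero =>
    intro π hl _ hi
    simp [List.length_eq_zero_iff.1 hl] at hi
  | succ k ih =>
    intro π hl hn hi hd
    rcases π with _ | ⟨a, t⟩
    · simp at hl
    have htl : t.length = k := by simpa using hl
    obtain ⟨hat, htn⟩ := List.nodup_cons.1 hn
    by_cases hmin : ∀ x ∈ t, a < x
    · exact encodesSubsets_of_min_cons hmin hi (ih t htl htn)
    by_cases hmax : ∀ x ∈ t, x < a
    · have hle : ∀ x ∈ a :: t, x ≤ a := by
        simpa using fun x hx => (hmax x hx).le
      have hflip : ∀ l : List ℕ, (∀ x ∈ l, x ≤ a) →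
          (((l.map (a - ·)).Pairwise (· < ·) ↔ l.Pairwise (· > ·)) ∧
          ((l.map (a - ·)).Pairwise (· > ·) ↔ l.Pairwise (· < ·))) := by
        intro l hla
        rw [List.pairwise_map, List.pairwise_map]
        constructor <;>
        · refine List.Pairwise.iff_of_mem fun {x y} hx hy => ?_
          have := hla x hx
          have := hla y hy
          omega
      have htle : ∀ x ∈ t, x ≤ a := fun x hx => (hmax x hx).le
      refine EncodesSubsets.compl hle ?_
      rw [List.map_cons]
      refine encodesSubsets_of_min_cons ?_ ?_ (ih _ (by simpa using htl) ?_)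
      · simp only [List.mem_map]
        rintro _ ⟨x, hx, rfl⟩
        have := hmax x hx
        omega
      · rw [← List.map_cons (f := (a - ·)), (hflip _ hle).1]
        exact hd
      · refine (List.nodup_map_iff_inj_on htn).2 fun x hx y hy hxy => ?_
        have := hmax x hx
        have := hmax y hy
        omega
    · push Not at hmin hmax
      obtain ⟨x, hx, hxa⟩ := hmin
      obtain ⟨y, hy, hay⟩ := hmax
      have hxa' : x < a := lt_of_le_of_ne hxa fun h => hat (h ▸ hx)
      have hay' : a < y := lt_of_le_of_ne hay fun h => hat (h ▸ hy)
      rcases t with _ | ⟨b, t⟩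
      · simp at hx
      · exact encodesSubsets_of_mid hn hx hxa' hy hay'

theorem two_pow_le_card_of_encoding {Q : Type} [Fintype Q] (A : StreamAlg Q) {n m : ℕ}
    {π : List ℕ} (hA : SolvesSeqPPM A n π) (p : Finset ℕ → List ℕ) (s : ℕ → List ℕ)
    (h : ∀ S : Finset ℕ, ∀ i < m, IsDistinctSeqIn n (p S ++ s i) ∧
      (Contains (p S ++ s i) π ↔ i ∈ S)) : 2 ^ m ≤ Fintype.card Q := by
  rw [← Finset.card_range m, ← Finset.card_powerset, ← Finset.card_univ]
  refine Finset.card_le_card_of_injOn (fun S => A.run (p S)) (fun _ _ => Finset.mem_univ _) ?_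
  intro S hS T hT hST
  have key : ∀ i < m, (i ∈ S ↔ i ∈ T) := by
    intro i hi
    rw [← (h S i hi).2, ← (h T i hi).2, ← hA _ (h S i hi).1, ← hA _ (h T i hi).1]
    simp only [StreamAlg.run] at hST
    simp only [StreamAlg.Accepts, StreamAlg.run, List.foldl_append, hST]
  simp only [Finset.coe_powerset, Set.mem_preimage, Set.mem_powerset_iff, Finset.coe_subset]
    at hS hT
  ext i
  exact ⟨fun hi => (key i (by simpa using hS hi)).1 hi,
    fun hi => (key i (by simpa using hT hi)).2 hi⟩

/-- For every non-monotone pattern `π` there are constants `c > 0` and `N` such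
that for all `n ≥ N`, every deterministic single-pass streaming algorithm solving
`π`-SequencePPM_n uses at least `c·n` bits of space, i.e. has at least `2^{c·n}` states. -/
theorem stmt9 (π : List ℕ) (hπ : IsPattern π)
    (hnonmono : ¬(π = IncPattern π.length ∨ π = DecPattern π.length)) :
    ∃ c : ℝ, 0 < c ∧ ∃ N : ℕ, ∀ n : ℕ, N ≤ n →
      ∀ (Q : Type) [inst : Fintype Q] (A : StreamAlg Q),
        SolvesSeqPPM A n π →
          (2 : ℝ) ^ (c * n) ≤ (Fintype.card Q : ℝ) := by
  have hlt : (List.range' 1 π.length).Pairwise (· < ·) := List.pairwise_lt_range'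
  have hinc : ¬ π.Pairwise (· < ·) := fun h => hnonmono (Or.inl
    (List.Perm.eq_of_pairwise (fun x y _ _ h1 h2 => absurd h1 (lt_asymm h2)) h hlt hπ))
  have hdec : ¬ π.Pairwise (· > ·) := fun h => hnonmono (Or.inr
    (List.Perm.eq_of_pairwise (fun x y _ _ h1 h2 => absurd h1 (lt_asymm h2)) h
      (List.pairwise_reverse.2 hlt) (hπ.trans (List.reverse_perm _).symm)))
  have hnd : π.Nodup := hπ.nodup_iff.2 (hlt.imp fun h => ne_of_lt h)
  obtain ⟨C, hC, h⟩ := encodesSubsets_of_nonmonotone _ π rfl hnd hinc hdec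
  have hC' : (0 : ℝ) < C := by exact_mod_cast hC
  refine ⟨1 / (2 * C), by positivity, 4 * C, fun n hn Q _ A hA => ?_⟩
  obtain ⟨p, s, hps⟩ := h (n / C - 1)
  have hq : 4 ≤ n / C := (Nat.le_div_iff_mul_le hC).2 hn
  have hle : C * (n / C - 1 + 1) ≤ n := by
    rw [Nat.sub_add_cancel (by omega)]
    exact Nat.mul_div_le n C
  have hcard := two_pow_le_card_of_encoding A hA p s fun S i hi =>
    ⟨⟨(hps S i hi).1.1, fun x hx =>
      ⟨((hps S i hi).1.2 x hx).1, ((hps S i hi).1.2 x hx).2.trans hle⟩⟩, (hps S i hi).2⟩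
  have hbits : 1 / (2 * (C : ℝ)) * n ≤ ((n / C - 1 : ℕ) : ℝ) := by
    have h1 : n < C * (n / C + 1) := by
      have := Nat.lt_mul_div_succ n hC
      simpa using this
    have h2 : n ≤ 2 * C * (n / C - 1) := by
      refine h1.le.trans ?_
      rw [mul_comm 2 C, mul_assoc]
      exact Nat.mul_le_mul_left C (by omega)
    have h3 : (n : ℝ) ≤ 2 * C * ((n / C - 1 : ℕ) : ℝ) := by exact_mod_cast h2
    rw [one_div, inv_mul_le_iff₀ (by positivity)]
    exact h3
  calc (2 : ℝ) ^ (1 / (2 * (C : ℝ)) * n)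
      ≤ (2 : ℝ) ^ ((n / C - 1 : ℕ) : ℝ) := Real.rpow_le_rpow_of_exponent_le (by norm_num) hbits
    _ = ((2 ^ (n / C - 1) : ℕ) : ℝ) := by rw [Real.rpow_natCast]; push_cast; rfl
    _ ≤ (Fintype.card Q : ℝ) := by exact_mod_cast hcard
end

section
/- Let n ≥ 1 and S, T ⊆ [n]. Let f₁(S) be the sequence obtained by listing, for each i ∈ S in ascending order of i, the two values 3i and 3i−2 (in this order), and let g₁(T) be the sequence listing the values 3i−1 for i ∈ T in descending order of i. Then the concatenated sequence f₁(S)g₁(T), a sequence of distinct values in [3n], contains the pattern 312 if and only if S ∩ T ≠ ∅. -/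
/-- `f₁(S)`: for each `i ∈ S` in ascending order, the values `3i, 3i−2`. -/
def fOne (n : ℕ) (S : Finset ℕ) : List ℕ :=
  ((List.range' 1 n).filter (fun i => decide (i ∈ S))).flatMap (fun i => [3 * i, 3 * i - 2])

/-- `g₁(T)`: the values `3i−1` for `i ∈ T`, in descending order. -/
def gOne (n : ℕ) (T : Finset ℕ) : List ℕ :=
  (((List.range' 1 n).filter (fun i => decide (i ∈ T))).reverse).map (fun i => 3 * i - 1)

theorem contains_three_one_two_iff (τ : List ℕ) :
    Contains τ [3, 1, 2] ↔ ∃ a b c, [a, b, c].Sublist τ ∧ b < c ∧ c < a := by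
  constructor
  · rintro ⟨f, hf, h⟩
    refine ⟨τ.get (f 0), τ.get (f 1), τ.get (f 2), ?_, (h 1 2).2 (by decide),
      (h 2 0).2 (by decide)⟩
    rw [List.sublist_iff_exists_fin_orderEmbedding_get_eq]
    refine ⟨OrderEmbedding.ofStrictMono f hf, fun j => ?_⟩
    fin_cases j <;> rfl
  · rintro ⟨a, b, c, hs, hbc, hca⟩
    obtain ⟨f, hf⟩ := List.sublist_iff_exists_fin_orderEmbedding_get_eq.1 hs
    refine ⟨f, f.strictMono, fun j l => ?_⟩
    have key : [a, b, c].get j < [a, b, c].get l ↔ [3, 1, 2].get j < [3, 1, 2].get l := by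
      fin_cases j <;> fin_cases l <;> simp <;> omega
    rw [← key, hf j, hf l]

theorem mem_fOne {n : ℕ} {S : Finset ℕ} {x : ℕ} (hx : x ∈ fOne n S) :
    ∃ i ∈ S, 1 ≤ i ∧ (x = 3 * i ∨ x = 3 * i - 2) := by
  simp only [fOne, List.mem_flatMap, List.mem_filter, List.mem_range'_1, decide_eq_true_eq,
    List.mem_cons, List.not_mem_nil, or_false] at hx
  obtain ⟨i, ⟨hi, hiS⟩, h⟩ := hx
  exact ⟨i, hiS, hi.1, h⟩

theorem mem_gOne {n : ℕ} {T : Finset ℕ} {x : ℕ} (hx : x ∈ gOne n T) :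
    ∃ i ∈ T, 1 ≤ i ∧ x = 3 * i - 1 := by
  simp only [gOne, List.mem_map, List.mem_reverse, List.mem_filter, List.mem_range'_1,
    decide_eq_true_eq] at hx
  obtain ⟨i, ⟨hi, hiT⟩, h⟩ := hx
  exact ⟨i, hiT, hi.1, h.symm⟩

/-- The only descents, consecutive or not, of `f₁(S)` are the pairs `3i, 3i−2`. -/
theorem pairwise_fOne (n : ℕ) (S : Finset ℕ) :
    (fOne n S).Pairwise (fun x y => x < y ∨ (x = y + 2 ∧ 3 ∣ x)) := by
  rw [fOne, List.pairwise_flatMap]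
  constructor
  · intro i hi
    have h1 : 1 ≤ i := (List.mem_range'_1.1 (List.mem_of_mem_filter hi)).1
    simp
    omega
  · refine ((List.pairwise_lt_range' (s := 1) (n := n)).filter _).imp ?_
    intro i j hij x hx y hy
    simp at hx hy
    omega

theorem pairwise_gOne (n : ℕ) (T : Finset ℕ) :
    (gOne n T).Pairwise (fun x y => y ≤ x) := by
  rw [gOne, List.pairwise_map, List.pairwise_reverse]
  refine ((List.pairwise_lt_range' (s := 1) (n := n)).filter _).imp ?_
  intro i j hij
  omega

theorem pair_sublist_fOne {n i : ℕ} {S : Finset ℕ} (hi : i ∈ Finset.Icc 1 n) (hiS : i ∈ S) :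
    [3 * i, 3 * i - 2].Sublist (fOne n S) := by
  rw [Finset.mem_Icc] at hi
  have hmem : i ∈ (List.range' 1 n).filter (fun i => decide (i ∈ S)) := by
    simp [List.mem_range'_1, hiS]
    omega
  simpa [fOne] using (List.singleton_sublist.2 hmem).flatMap (fun i => [3 * i, 3 * i - 2])

theorem mem_gOne_of_mem {n i : ℕ} {T : Finset ℕ} (hi : i ∈ Finset.Icc 1 n) (hiT : i ∈ T) :
    3 * i - 1 ∈ gOne n T := by
  rw [Finset.mem_Icc] at hi
  refine List.mem_map.2 ⟨i, ?_, rfl⟩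
  simp [List.mem_range'_1, hiT]
  omega

/-- For `n ≥ 1` and `S, T ⊆ [n]`, the sequence `f₁(S)g₁(T)` contains the
pattern 312 if and only if `S ∩ T ≠ ∅`. -/
theorem stmt10 (n : ℕ) (hn : 1 ≤ n) (S T : Finset ℕ)
    (hS : S ⊆ Finset.Icc 1 n) (hT : T ⊆ Finset.Icc 1 n) :
    Contains (fOne n S ++ gOne n T) [3, 1, 2] ↔ (S ∩ T).Nonempty := by
  rw [contains_three_one_two_iff]
  constructor
  · rintro ⟨a, b, c, hs, hbc, hca⟩
    obtain ⟨l₁, l₂, hl, h₁, h₂⟩ := List.sublist_append_iff.1 hs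
    have hf := (pairwise_fOne n S).sublist h₁
    have hg := (pairwise_gOne n T).sublist h₂
    rcases l₁ with _ | ⟨a', _ | ⟨b', _ | ⟨c', l₁⟩⟩⟩
    · obtain rfl : [a, b, c] = l₂ := hl
      simp at hg
      omega
    · obtain ⟨rfl, rfl⟩ : a = a' ∧ [b, c] = l₂ := by simpa using hl
      simp at hg
      omega
    · obtain ⟨rfl, rfl, rfl⟩ : a = a' ∧ b = b' ∧ [c] = l₂ := by simpa using hl
      simp at hf
      obtain ⟨i, hiS, hi, hai⟩ := mem_fOne (h₁.subset (by simp : a ∈ [a, b]))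
      obtain ⟨j, hjT, hj, hcj⟩ := mem_gOne (h₂.subset (by simp : c ∈ [c]))
      obtain rfl : i = j := by omega
      exact ⟨i, Finset.mem_inter.2 ⟨hiS, hjT⟩⟩
    · obtain ⟨rfl, rfl, rfl, -⟩ : a = a' ∧ b = b' ∧ c = c' ∧ [] = l₁ ++ l₂ := by
        simpa using hl
      obtain ⟨i, -, hi, hci⟩ := mem_fOne (h₁.subset (by simp : c ∈ a :: b :: c :: l₁))
      simp at hf
      omega
  · rintro ⟨i, hi⟩
    obtain ⟨hiS, hiT⟩ := Finset.mem_inter.1 hi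
    have h1 := Finset.mem_Icc.1 (hS hiS)
    refine ⟨3 * i, 3 * i - 2, 3 * i - 1, ?_, by omega, by omega⟩
    exact (pair_sublist_fOne (hS hiS) hiS).append
      (List.singleton_sublist.2 (mem_gOne_of_mem (hT hiT) hiT))
end

section
/- For every n ≥ 1, every deterministic single-pass streaming algorithm that solves 312-SequencePPM_{3n} has at least 2^n states. -/
theorem contains_312_iff {τ : List ℕ} :
    Contains τ [3, 1, 2] ↔ ∃ a b c, [a, b, c].Sublist τ ∧ b < c ∧ c < a := by
  constructor
  · rintro ⟨f, hf, h⟩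
    refine ⟨τ.get (f 0), τ.get (f 1), τ.get (f 2), ?_, (h 1 2).2 (by simp), (h 2 0).2 (by simp)⟩
    refine List.sublist_iff_exists_fin_orderEmbedding_get_eq.2
      ⟨OrderEmbedding.ofStrictMono f hf, fun i => ?_⟩
    change Fin 3 at i
    fin_cases i <;> rfl
  · rintro ⟨a, b, c, hs, hbc, hca⟩
    obtain ⟨f, hf⟩ := List.sublist_iff_exists_fin_orderEmbedding_get_eq.1 hs
    refine ⟨f, f.strictMono, fun j l => ?_⟩
    have h := hf j
    have h' := hf l
    rw [← h, ← h']
    change Fin 3 at j l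
    fin_cases j <;> fin_cases l <;> simp <;> omega

/-- The concatenation, over the elements `i` of `S` in increasing order, of the descents
`3i + 3, 3i + 1`. -/
def descents {n : ℕ} (S : Finset (Fin n)) : List ℕ :=
  ((List.finRange n).filter (· ∈ S)).flatMap fun i => [3 * i.val + 3, 3 * i.val + 1]

theorem mem_descents {n : ℕ} {S : Finset (Fin n)} {x : ℕ} :
    x ∈ descents S ↔ ∃ i ∈ S, x = 3 * i.val + 3 ∨ x = 3 * i.val + 1 := by
  simp [descents]

theorem descents_pairwise {n : ℕ} (S : Finset (Fin n)) :
    (descents S).Pairwise fun a b =>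
      a ≠ b ∧ (b < a → ∃ i ∈ S, a = 3 * i.val + 3 ∧ b = 3 * i.val + 1) := by
  refine List.pairwise_flatMap.2 ⟨fun i hi => ?_, ?_⟩
  · have : i ∈ S := by simpa using hi
    exact List.pairwise_pair.2 ⟨by omega, fun _ => ⟨i, this, rfl, rfl⟩⟩
  · refine ((List.pairwise_lt_finRange n).filter _).imp fun {i j} hij x hx y hy => ?_
    have : i.val < j.val := hij
    simp only [List.mem_cons, List.not_mem_nil, or_false] at hx hy
    exact ⟨by omega, fun h => by omega⟩

theorem descents_append_isDistinctSeqIn {n : ℕ} (S : Finset (Fin n)) (i : Fin n) :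
    IsDistinctSeqIn (3 * n) (descents S ++ [3 * i.val + 2]) := by
  constructor
  · refine List.nodup_append.2
      ⟨(descents_pairwise S).imp fun h => h.1, List.nodup_singleton _, fun x hx y hy => ?_⟩
    obtain ⟨j, -, hj⟩ := mem_descents.1 hx
    have := List.mem_singleton.1 hy
    omega
  · intro x hx
    rcases List.mem_append.1 hx with hx | hx
    · obtain ⟨j, -, hj⟩ := mem_descents.1 hx
      omega
    · have := List.mem_singleton.1 hx
      omega

theorem contains_descents_append_iff {n : ℕ} (S : Finset (Fin n)) (i : Fin n) :
    Contains (descents S ++ [3 * i.val + 2]) [3, 1, 2] ↔ i ∈ S := by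
  rw [contains_312_iff]
  constructor
  · rintro ⟨a, b, c, hs, hbc, hca⟩
    have hab : [a, b].Sublist (descents S) := by
      simpa using hs.reverse.tail.reverse
    obtain ⟨j, hj, rfl, rfl⟩ :=
      (List.pairwise_pair.1 ((descents_pairwise S).sublist hab)).2 (by omega)
    have hc : c ∈ descents S ++ [3 * i.val + 2] := hs.subset (by simp)
    rcases List.mem_append.1 hc with hc | hc
    · obtain ⟨k, -, hk⟩ := mem_descents.1 hc
      omega
    · have := List.mem_singleton.1 hc
      obtain rfl : i = j := Fin.ext (by omega)
      exact hj
  · intro hi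
    have hs : [3 * i.val + 3, 3 * i.val + 1].Sublist (descents S) :=
      List.sublist_flatten_of_mem (List.mem_map.2 ⟨i, by simpa using hi, rfl⟩)
    exact ⟨3 * i.val + 3, 3 * i.val + 1, 3 * i.val + 2, hs.append (List.Sublist.refl _),
      by omega, by omega⟩

/-- For every `n ≥ 1`, every deterministic single-pass streaming algorithm
solving 312-SequencePPM_{3n} has at least `2^n` states. -/
theorem stmt11 (n : ℕ) (hn : 1 ≤ n) (Q : Type) [Fintype Q] (A : StreamAlg Q)
    (hA : SolvesSeqPPM A (3 * n) [3, 1, 2]) :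
    2 ^ n ≤ Fintype.card Q := by
  have hinj : Function.Injective fun S : Finset (Fin n) => A.run (descents S) := by
    intro S T hST
    have hrun : A.run (descents S) = A.run (descents T) := hST
    ext i
    rw [← contains_descents_append_iff S, ← contains_descents_append_iff T,
      ← hA _ (descents_append_isDistinctSeqIn S i), ← hA _ (descents_append_isDistinctSeqIn T i)]
    unfold StreamAlg.run at hrun
    simp only [StreamAlg.Accepts, StreamAlg.run, List.foldl_append, hrun]
  simpa using Fintype.card_le_of_injective _ hinj
end

section
/- For every n ≥ 1, every deterministic single-pass streaming algorithm that solves 4231-PPM_{4n} has at least 2^n states. -/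
/-- The concatenation over `j < n` of the pairs `4j + c, 4j + c + 2`, the `j`-th pair being
written in decreasing order exactly when `s j` holds. -/
def pairBlocks (n c : ℕ) (s : ℕ → Bool) : List ℕ :=
  (List.range n).flatMap fun j =>
    if s j then [4 * j + c + 2, 4 * j + c] else [4 * j + c, 4 * j + c + 2]

theorem mem_pairBlocks {n c : ℕ} {s : ℕ → Bool} {x : ℕ} :
    x ∈ pairBlocks n c s ↔ ∃ j < n, x = 4 * j + c ∨ x = 4 * j + c + 2 := by
  simp only [pairBlocks, List.mem_flatMap, List.mem_range]
  refine exists_congr fun j => and_congr_right fun _ => ?_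
  split <;> simp [or_comm]

/-- The only inversions of `pairBlocks n c s` are the pairs written in decreasing order. -/
theorem pairwise_pairBlocks (n c : ℕ) (s : ℕ → Bool) :
    (pairBlocks n c s).Pairwise fun x y =>
      x < y ∨ ∃ j, s j = true ∧ x = 4 * j + c + 2 ∧ y = 4 * j + c := by
  rw [pairBlocks, List.pairwise_flatMap]
  refine ⟨fun j _ => ?_, List.pairwise_lt_range.imp fun {i j} hij x hx y hy => Or.inl ?_⟩
  · split
    · simpa using ‹s j = true›
    · simp
  · split at hx <;> split at hy <;> simp at hx hy <;> omega

theorem inversion_of_sublist_pairBlocks {n c : ℕ} {s : ℕ → Bool} {x y : ℕ}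
    (h : [x, y].Sublist (pairBlocks n c s)) (hyx : y < x) :
    ∃ j, s j = true ∧ x = 4 * j + c + 2 ∧ y = 4 * j + c := by
  have := (pairwise_pairBlocks n c s).sublist h
  simp only [List.pairwise_cons, List.mem_singleton, forall_eq] at this
  exact this.1.resolve_left hyx.not_gt

theorem nodup_pairBlocks (n c : ℕ) (s : ℕ → Bool) : (pairBlocks n c s).Nodup :=
  (pairwise_pairBlocks n c s).imp fun h => by
    rcases h with h | ⟨j, -, rfl, rfl⟩ <;> omega

theorem isPermOf_pairBlocks_append (n : ℕ) (s t : ℕ → Bool) :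
    IsPermOf (4 * n) (pairBlocks n 2 s ++ pairBlocks n 1 t) := by
  refine (List.perm_ext_iff_of_nodup ?_ List.nodup_range').2 fun x => ?_
  · refine (nodup_pairBlocks n 2 s).append (nodup_pairBlocks n 1 t) fun x hx hy => ?_
    obtain ⟨i, -, hi⟩ := mem_pairBlocks.1 hx
    obtain ⟨j, -, hj⟩ := mem_pairBlocks.1 hy
    omega
  · rw [List.mem_append, mem_pairBlocks, mem_pairBlocks, List.mem_range'_1]
    constructor
    · rintro (⟨j, hj, h⟩ | ⟨j, hj, h⟩) <;> omega
    · intro h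
      rcases Nat.even_or_odd x with he | ho
      · obtain ⟨k, hk⟩ := he
        exact Or.inl ⟨(x - 1) / 4, by omega, by omega⟩
      · obtain ⟨k, hk⟩ := ho
        exact Or.inr ⟨(x - 1) / 4, by omega, by omega⟩

theorem contains_4231_iff (τ : List ℕ) :
    Contains τ [4, 2, 3, 1] ↔
      ∃ a b c d, [a, b, c, d].Sublist τ ∧ d < b ∧ b < c ∧ c < a := by
  constructor
  · rintro ⟨f, hf, h⟩
    refine ⟨τ.get (f 0), τ.get (f 1), τ.get (f 2), τ.get (f 3), ?_,
      (h 3 1).2 (by simp), (h 1 2).2 (by simp), (h 2 0).2 (by simp)⟩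
    refine List.sublist_iff_exists_fin_orderEmbedding_get_eq.2
      ⟨OrderEmbedding.ofStrictMono f hf, fun i => ?_⟩
    change Fin 4 at i
    fin_cases i <;> rfl
  · rintro ⟨a, b, c, d, hs, h₁, h₂, h₃⟩
    obtain ⟨f, hf⟩ := List.sublist_iff_exists_fin_orderEmbedding_get_eq.1 hs
    refine ⟨f, f.strictMono, fun j l => ?_⟩
    have hj := hf j
    have hl := hf l
    rw [← hj, ← hl]
    change Fin 4 at j l
    fin_cases j <;> fin_cases l <;> simp <;> omega

/-- The even half is unconstrained; the odd half has the single inversion `4i + 3, 4i + 1`, which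
completes an occurrence of `4231` exactly when `4i + 4` precedes `4i + 2`. -/
theorem contains_4231_pairBlocks_append_iff {n i : ℕ} (hi : i < n) (s : ℕ → Bool) :
    Contains (pairBlocks n 2 s ++ pairBlocks n 1 (fun j => decide (j = i))) [4, 2, 3, 1] ↔
      s i = true := by
  rw [contains_4231_iff]
  constructor
  · rintro ⟨a, b, c, d, h, hdb, hbc, hca⟩
    obtain ⟨l₁, l₂, hl, h₁, h₂⟩ := List.sublist_append_iff.1 h
    have left : ¬ [a, b, c].Sublist (pairBlocks n 2 s) := fun h => by
      obtain ⟨j, -, hj⟩ := inversion_of_sublist_pairBlocks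
        (List.Sublist.trans (l₂ := [a, b, c]) (by simp) h) (hbc.trans hca)
      obtain ⟨k, -, hk⟩ := inversion_of_sublist_pairBlocks
        (List.Sublist.trans (l₁ := [a, c]) (l₂ := [a, b, c]) (by simp) h) hca
      omega
    have right : ¬ [b, c, d].Sublist (pairBlocks n 1 (fun j => decide (j = i))) := fun h => by
      obtain ⟨j, -, hj⟩ := inversion_of_sublist_pairBlocks
        (List.Sublist.trans (l₁ := [b, d]) (l₂ := [b, c, d]) (by simp) h) hdb
      obtain ⟨k, -, hk⟩ := inversion_of_sublist_pairBlocks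
        (List.Sublist.trans (l₁ := [c, d]) (l₂ := [b, c, d]) (by simp) h) (hdb.trans hbc)
      omega
    rcases l₁ with _ | ⟨x, _ | ⟨y, _ | ⟨z, l₁⟩⟩⟩
    · obtain rfl : [a, b, c, d] = l₂ := by simpa using hl
      exact (right ((List.sublist_cons_self _ _).trans h₂)).elim
    · simp only [List.cons_append, List.nil_append, List.cons.injEq] at hl
      exact (right (hl.2 ▸ h₂)).elim
    · simp only [List.cons_append, List.nil_append, List.cons.injEq] at hl
      obtain ⟨rfl, rfl, rfl⟩ := hl
      obtain ⟨j, hsj, hj⟩ := inversion_of_sublist_pairBlocks h₁ (hbc.trans hca)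
      obtain ⟨k, hki, hk⟩ := inversion_of_sublist_pairBlocks h₂ (hdb.trans hbc)
      obtain rfl : k = i := of_decide_eq_true hki
      obtain rfl : j = k := by omega
      exact hsj
    · simp only [List.cons_append, List.cons.injEq] at hl
      obtain ⟨rfl, rfl, rfl, -⟩ := hl
      exact (left (List.Sublist.trans (by simp) h₁)).elim
  · intro hs
    have block (c : ℕ) (t : ℕ → Bool) (ht : t i = true) :
        [4 * i + c + 2, 4 * i + c].Sublist (pairBlocks n c t) := by
      have := List.sublist_flatten_of_mem (List.mem_map_of_mem
        (f := fun j => if t j then [4 * j + c + 2, 4 * j + c] else [4 * j + c, 4 * j + c + 2])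
        (List.mem_range.2 hi))
      simpa [pairBlocks, List.flatMap_def, ht] using this
    exact ⟨_, _, _, _, (block 2 s hs).append (block 1 _ (by simp)),
      by omega, by omega, by omega⟩

/-- For every `n ≥ 1`, every deterministic single-pass streaming algorithm
solving 4231-PPM_{4n} has at least `2^n` states. -/
theorem stmt16 (n : ℕ) (hn : 1 ≤ n) (Q : Type) [Fintype Q] (A : StreamAlg Q)
    (hA : SolvesPPM A (4 * n) [4, 2, 3, 1]) :
    2 ^ n ≤ Fintype.card Q := by
  let ext (s : Fin n → Bool) (j : ℕ) : Bool := if h : j < n then s ⟨j, h⟩ else false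
  have inj : Function.Injective fun s : Fin n → Bool => A.run (pairBlocks n 2 (ext s)) := by
    intro s s' hss
    funext i
    have key (u : Fin n → Bool) :
        A.Accepts (pairBlocks n 2 (ext u) ++ pairBlocks n 1 (fun j => decide (j = i))) ↔
          u i = true := by
      rw [hA _ (isPermOf_pairBlocks_append n _ _), contains_4231_pairBlocks_append_iff i.2]
      simp [ext]
    rw [Bool.eq_iff_iff, ← key s, ← key s']
    simp only [StreamAlg.run] at hss
    simp only [StreamAlg.Accepts, StreamAlg.run, List.foldl_append, hss]
  simpa using Fintype.card_le_of_injective _ inj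
end

section
/- There exists a constant C such that for every n ≥ 2 and each π ∈ {231, 213}, there is a deterministic single-pass streaming algorithm that solves π-PPM_n using at most C·√n·log₂ n bits of space, i.e., having at most 2^{C·√n·log₂ n} states. -/
/-- Valid reversed prefixes: pairwise distinct values from `[n]`. -/
def ValidRev (n : ℕ) (r : List ℕ) : Prop := r.Nodup ∧ ∀ x ∈ r, 1 ≤ x ∧ x ≤ n

theorem validRev_reverse {n : ℕ} {τ : List ℕ} (hτ : IsPermOf n τ) : ValidRev n τ.reverse := by
  refine ⟨List.nodup_reverse.2 (hτ.nodup_iff.2 List.nodup_range'), fun x hx => ?_⟩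
  have := hτ.mem_iff.1 (List.mem_reverse.1 hx)
  rw [List.mem_range'_1] at this
  omega

/-- An invariant `φ` of reversed prefixes which is a right congruence and decides `P` on
permutations yields a streaming algorithm with the codomain of `φ` as states. -/
theorem exists_streamAlg_of_congruence {D : Type} (n : ℕ) (φ : List ℕ → D) (P : List ℕ → Prop)
    (hstep : ∀ r r' x, ValidRev n (x :: r) → ValidRev n (x :: r') → φ r = φ r' →
      φ (x :: r) = φ (x :: r'))
    (hacc : ∀ τ τ', IsPermOf n τ → IsPermOf n τ' → φ τ.reverse = φ τ'.reverse → P τ → P τ') :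
    ∃ A : StreamAlg D, ∀ τ, IsPermOf n τ → (A.Accepts τ ↔ P τ) := by
  classical
  let A : StreamAlg D :=
    { q0 := φ []
      F := {q | ∃ τ, IsPermOf n τ ∧ φ τ.reverse = q ∧ P τ}
      t := fun q x => if h : ∃ r, ValidRev n (x :: r) ∧ φ r = q then φ (x :: h.choose) else q }
  have hrun : ∀ r : List ℕ, ValidRev n r → A.run r.reverse = φ r := by
    intro r
    induction r with
    | nil => intro _; rfl
    | cons x r ih =>
      intro hv
      have hr : ValidRev n r := ⟨hv.1.of_cons, fun y hy => hv.2 y (List.mem_cons_of_mem _ hy)⟩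
      have h1 : A.run (x :: r).reverse = A.t (A.run r.reverse) x := by
        simp [StreamAlg.run]
      rw [h1, ih hr]
      have h : ∃ r', ValidRev n (x :: r') ∧ φ r' = φ r := ⟨r, hv, rfl⟩
      have h2 : A.t (φ r) x = φ (x :: h.choose) := dif_pos h
      rw [h2]
      exact hstep _ _ _ h.choose_spec.1 hv h.choose_spec.2
  refine ⟨A, fun τ hτ => ?_⟩
  have := hrun _ (validRev_reverse hτ)
  rw [List.reverse_reverse] at this
  unfold StreamAlg.Accepts
  rw [this]
  constructor
  · rintro ⟨τ', hτ', he, hP⟩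
    exact hacc _ _ hτ' hτ he hP
  · intro hP
    exact ⟨τ, hτ, rfl, hP⟩

/-- The reversed list contains `213`, read backwards. -/
def HasPat (r : List ℕ) : Prop := ∃ a b c, a < b ∧ b < c ∧ [c, a, b].Sublist r

theorem HasPat.mono {r s : List ℕ} (h : HasPat r) (hs : r.Sublist s) : HasPat s := by
  obtain ⟨a, b, c, h1, h2, h3⟩ := h
  exact ⟨a, b, c, h1, h2, h3.trans hs⟩

/-- The maximum of a list, `0` if empty. -/
def listMax (w : List ℕ) : ℕ := w.foldr max 0

/-- The minimum of a list and `n + 1`. -/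
def listMin (n : ℕ) (w : List ℕ) : ℕ := w.foldr min (n + 1)

theorem lt_listMax {x : ℕ} {w : List ℕ} : x < listMax w ↔ ∃ b ∈ w, x < b := by
  induction w with
  | nil => simp [listMax]
  | cons y w ih =>
    have : listMax (y :: w) = max y (listMax w) := rfl
    rw [this, lt_max_iff, ih]
    simp

theorem listMin_lt {n x : ℕ} {w : List ℕ} (hx : x ≤ n + 1) :
    listMin n w < x ↔ ∃ b ∈ w, b < x := by
  induction w with
  | nil => simp [listMin]; omega
  | cons y w ih =>
    have : listMin n (y :: w) = min y (listMin n w) := rfl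
    rw [this, min_lt_iff, ih]
    simp

theorem listMin_le_of_mem {n x : ℕ} {w : List ℕ} (hx : x ∈ w) : listMin n w ≤ x := by
  induction w with
  | nil => simp at hx
  | cons y w ih =>
    have : listMin n (y :: w) = min y (listMin n w) := rfl
    rw [this]
    rcases List.mem_cons.1 hx with rfl | h
    · exact min_le_left _ _
    · exact (min_le_right _ _).trans (ih h)

theorem listMin_le (n : ℕ) (w : List ℕ) : listMin n w ≤ n + 1 := by
  induction w with
  | nil => exact le_rfl
  | cons y w ih => exact (min_le_right _ _).trans ih

theorem listMin_mem {n : ℕ} {w : List ℕ} (h : listMin n w ≤ n) : listMin n w ∈ w := by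
  obtain ⟨b, hb, hlt⟩ := (listMin_lt (x := listMin n w + 1) (by omega)).1 (Nat.lt_succ_self _)
  have := listMin_le_of_mem (n := n) hb
  have h2 : listMin n w = b := by omega
  rwa [h2]

theorem listMax_le {n : ℕ} {w : List ℕ} (h : ∀ b ∈ w, b ≤ n) : listMax w ≤ n := by
  by_contra hc
  obtain ⟨b, hb, hlt⟩ := lt_listMax.1 (not_le.1 hc)
  exact absurd (h b hb) (by omega)

/-- The part of a reversed list read after its longest increasing start. -/
def tailPart : List ℕ → List ℕ
  | [] => []
  | x :: w => if tailPart w = [] ∧ listMax w < x then [] else x :: tailPart w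

theorem exists_eq_tailPart_append (w : List ℕ) :
    ∃ s, w = tailPart w ++ s ∧ s.Pairwise (· > ·) := by
  induction w with
  | nil => exact ⟨[], by simp [tailPart]⟩
  | cons x w ih =>
    obtain ⟨s, hs, hp⟩ := ih
    by_cases h : tailPart w = [] ∧ listMax w < x
    · refine ⟨x :: w, by simp [tailPart, h], ?_⟩
      rw [h.1, List.nil_append] at hs
      rw [List.pairwise_cons]
      refine ⟨fun b hb => ?_, hs ▸ hp⟩
      by_contra hc
      have := (lt_listMax (x := b - 1) (w := w))
      by_cases hb0 : b = 0
      · omega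
      · have := this.2 ⟨b, hb, by omega⟩
        omega
    · refine ⟨s, ?_, hp⟩
      rw [tailPart, if_neg h, List.cons_append, ← hs]

theorem tailPart_sublist (w : List ℕ) : (tailPart w).Sublist w := by
  obtain ⟨s, hs, -⟩ := exists_eq_tailPart_append w
  conv_rhs => rw [hs]
  exact List.sublist_append_left _ _

/-- The entries of `r` in the block `j` of values, blocks having length `m`. -/
def blockPart (m : ℕ) (r : List ℕ) (j : ℕ) : List ℕ := r.filter (fun y => y / m = j)

theorem mem_blockPart {m j y : ℕ} {r : List ℕ} :
    y ∈ blockPart m r j ↔ y ∈ r ∧ y / m = j := by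
  simp [blockPart]

theorem blockPart_cons_self {m x : ℕ} {r : List ℕ} :
    blockPart m (x :: r) (x / m) = x :: blockPart m r (x / m) := by
  simp [blockPart]

theorem blockPart_cons_of_ne {m x j : ℕ} {r : List ℕ} (h : x / m ≠ j) :
    blockPart m (x :: r) j = blockPart m r j := by
  simp [blockPart, h]

theorem ValidRev.of_cons {n x : ℕ} {r : List ℕ} (h : ValidRev n (x :: r)) : ValidRev n r :=
  ⟨h.1.of_cons, fun y hy => h.2 y (List.mem_cons_of_mem _ hy)⟩

theorem ValidRev.nodup_blockPart {n m j : ℕ} {r : List ℕ} (h : ValidRev n r) :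
    (blockPart m r j).Nodup := h.1.filter _

/-- All values of the block `j` occur in `r`. -/
def BlockFull (n m : ℕ) (r : List ℕ) (j : ℕ) : Prop :=
  ∀ c, 1 ≤ c → c ≤ n → c / m = j → c ∈ r

/-- The values of `[n]` in the block `j`. -/
def block (n m j : ℕ) : Finset ℕ := (Finset.Icc 1 n).filter (fun y => y / m = j)

theorem mem_block {n m j y : ℕ} : y ∈ block n m j ↔ (1 ≤ y ∧ y ≤ n) ∧ y / m = j := by
  simp [block]

theorem ValidRev.blockPart_subset {n m j : ℕ} {r : List ℕ} (h : ValidRev n r) :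
    (blockPart m r j).toFinset ⊆ block n m j := by
  intro y hy
  rw [List.mem_toFinset, mem_blockPart] at hy
  exact mem_block.2 ⟨h.2 y hy.1, hy.2⟩

theorem blockFull_iff {n m j : ℕ} {r : List ℕ} (h : ValidRev n r) :
    BlockFull n m r j ↔ (block n m j).card ≤ (blockPart m r j).length := by
  rw [← List.toFinset_card_of_nodup h.nodup_blockPart]
  constructor
  · intro hf
    refine Finset.card_le_card fun y hy => ?_
    obtain ⟨⟨h1, h2⟩, h3⟩ := mem_block.1 hy
    exact List.mem_toFinset.2 (mem_blockPart.2 ⟨hf y h1 h2 h3, h3⟩)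
  · intro hc y h1 h2 h3
    have := Finset.eq_of_subset_of_card_le h.blockPart_subset hc
    have hy : y ∈ (blockPart m r j).toFinset := this ▸ mem_block.2 ⟨⟨h1, h2⟩, h3⟩
    exact (mem_blockPart.1 (List.mem_toFinset.1 hy)).1

theorem BlockFull.cons {n m j : ℕ} {r : List ℕ} (x : ℕ) (h : BlockFull n m r j) :
    BlockFull n m (x :: r) j :=
  fun c h1 h2 h3 => List.mem_cons_of_mem _ (h c h1 h2 h3)

theorem blockPart_eq_of_full {n m j : ℕ} {r r' : List ℕ} (h : ValidRev n r) (h' : ValidRev n r')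
    (hf : BlockFull n m r j) (hf' : BlockFull n m r' j)
    (ht : tailPart (blockPart m r j) = tailPart (blockPart m r' j)) :
    blockPart m r j = blockPart m r' j := by
  obtain ⟨s, hs, hp⟩ := exists_eq_tailPart_append (blockPart m r j)
  obtain ⟨s', hs', hp'⟩ := exists_eq_tailPart_append (blockPart m r' j)
  have hperm : (blockPart m r j).Perm (blockPart m r' j) := by
    rw [List.perm_ext_iff_of_nodup h.nodup_blockPart h'.nodup_blockPart]
    intro y
    rw [mem_blockPart, mem_blockPart]
    constructor
    · rintro ⟨hy, hj⟩
      exact ⟨hf' y (h.2 y hy).1 (h.2 y hy).2 hj, hj⟩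
    · rintro ⟨hy, hj⟩
      exact ⟨hf y (h'.2 y hy).1 (h'.2 y hy).2 hj, hj⟩
  rw [hs, hs', ← ht, List.perm_append_left_iff] at hperm
  have : s = s' := hperm.eq_of_pairwise (fun a b _ _ h1 h2 => absurd h1 (not_lt.2 h2.le)) hp hp'
  rw [hs, hs', ← ht, this]

/-- Appending `x` to the reversed prefix `r` does not force an occurrence of `213` whose entries
meet at least two blocks. -/
def StepOk (n m : ℕ) (r : List ℕ) (x : ℕ) : Prop :=
  ∀ b ∈ r, x < b → ∀ c, c ≤ n → b < c → c ∉ r → x / m = b / m ∧ b / m = c / m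

/-- No step has forced an occurrence of `213` meeting at least two blocks. -/
def Live (n m : ℕ) : List ℕ → Prop
  | [] => True
  | x :: r => Live n m r ∧ StepOk n m r x

theorem Live.same_block_of_not_mem {n m a b c : ℕ} {r : List ℕ} (h : Live n m r) (hab : a < b)
    (hbc : b < c) (hc : c ≤ n) (hcr : c ∉ r) (hs : [a, b].Sublist r) :
    a / m = b / m ∧ b / m = c / m := by
  induction r with
  | nil => simp at hs
  | cons x r ih =>
    have hcr' : c ∉ r := fun hm => hcr (List.mem_cons_of_mem _ hm)
    rcases List.sublist_cons_iff.1 hs with hs | ⟨l, hl, hs⟩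
    · exact ih h.1 hcr' hs
    · obtain ⟨rfl, rfl⟩ := List.cons.inj hl
      exact h.2 b (List.singleton_sublist.1 hs) hab c hc hbc hcr'

theorem Live.same_block {n m a b c : ℕ} {r : List ℕ} (h : Live n m r) (hv : ValidRev n r)
    (hab : a < b) (hbc : b < c) (hs : [c, a, b].Sublist r) :
    a / m = b / m ∧ b / m = c / m := by
  induction r with
  | nil => simp at hs
  | cons x r ih =>
    rcases List.sublist_cons_iff.1 hs with hs | ⟨l, hl, hs⟩
    · exact ih h.1 hv.of_cons hs
    · obtain ⟨rfl, rfl⟩ := List.cons.inj hl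
      exact h.1.same_block_of_not_mem hab hbc (hv.2 c List.mem_cons_self).2
        (List.nodup_cons.1 hv.1).1 hs

theorem exists_of_not_live {n m : ℕ} {r : List ℕ} (hv : ValidRev n r) (h : ¬ Live n m r) :
    ∃ a b c, a < b ∧ b < c ∧ c ≤ n ∧ ([c, a, b].Sublist r ∨ (c ∉ r ∧ [a, b].Sublist r)) := by
  induction r with
  | nil => exact absurd trivial h
  | cons x r ih =>
    by_cases hl : Live n m r
    · have hok : ¬ StepOk n m r x := fun hok => h ⟨hl, hok⟩
      unfold StepOk at hok
      push Not at hok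
      obtain ⟨b, hb, hxb, c, hc, hbc, hcr, -⟩ := hok
      refine ⟨x, b, c, hxb, hbc, hc, Or.inr ⟨?_, (List.singleton_sublist.2 hb).cons_cons x⟩⟩
      rw [List.mem_cons]
      rintro (rfl | hm)
      · omega
      · exact hcr hm
    · obtain ⟨a, b, c, hab, hbc, hc, hs⟩ := ih hv.of_cons hl
      refine ⟨a, b, c, hab, hbc, hc, ?_⟩
      rcases hs with hs | ⟨hcr, hs⟩
      · exact Or.inl (hs.cons x)
      · by_cases hcx : c = x
        · subst hcx
          exact Or.inl (hs.cons_cons c)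
        · refine Or.inr ⟨?_, hs.cons x⟩
          rw [List.mem_cons]
          tauto

/-- Some completely read block contains `213`. -/
def FullBlockPat (n m : ℕ) (r : List ℕ) : Prop :=
  ∃ j, BlockFull n m r j ∧ HasPat (blockPart m r j)

theorem hasPat_iff {n m : ℕ} {r : List ℕ} (hv : ValidRev n r)
    (hall : ∀ c, 1 ≤ c → c ≤ n → c ∈ r) :
    HasPat r ↔ ¬ Live n m r ∨ FullBlockPat n m r := by
  constructor
  · rintro ⟨a, b, c, hab, hbc, hs⟩
    by_cases hl : Live n m r
    · obtain ⟨h1, h2⟩ := hl.same_block hv hab hbc hs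
      refine Or.inr ⟨c / m, fun y hy1 hy2 _ => hall y hy1 hy2, a, b, c, hab, hbc, ?_⟩
      have := hs.filter (fun y => decide (y / m = c / m))
      simpa [h1, h2, blockPart] using this
    · exact Or.inl hl
  · rintro (hl | ⟨j, -, hp⟩)
    · obtain ⟨a, b, c, hab, hbc, hc, hs⟩ := exists_of_not_live hv hl
      rcases hs with hs | ⟨hcr, -⟩
      · exact ⟨a, b, c, hab, hbc, hs⟩
      · exact absurd (hall c (by omega) hc) hcr
    · exact hp.mono List.filter_sublist

theorem Live.blockFull_of_tailPart_ne_nil {n m j k : ℕ} {r : List ℕ} (h : Live n m r)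
    (hv : ValidRev n r) (ht : tailPart (blockPart m r j) ≠ []) (hjk : j < k) :
    BlockFull n m r k := by
  induction r with
  | nil => simp [blockPart, tailPart] at ht
  | cons x r ih =>
    by_cases hx : x / m = j
    · subst hx
      rw [blockPart_cons_self] at ht
      by_cases ht' : tailPart (blockPart m r (x / m)) = []
      · have hmax : ¬ listMax (blockPart m r (x / m)) < x := by
          intro hlt
          exact ht (by simp [tailPart, ht', hlt])
        have hx1 := (hv.2 x List.mem_cons_self).1
        obtain ⟨b, hb, hlt⟩ := (lt_listMax (x := x - 1)).1 (by omega :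
          x - 1 < listMax (blockPart m r (x / m)))
        obtain ⟨hbr, hbm⟩ := mem_blockPart.1 hb
        have hne : b ≠ x := by
          rintro rfl
          exact (List.nodup_cons.1 hv.1).1 hbr
        intro c hc1 hc2 hck
        by_contra hcr
        have hbc : b < c := by
          by_contra hcb
          have := Nat.div_le_div_right (c := m) (not_lt.1 hcb)
          omega
        have := h.2 b hbr (by omega) c hc2 hbc (fun hm => hcr (List.mem_cons_of_mem _ hm))
        omega
      · exact (ih h.1 hv.of_cons ht').cons x
    · rw [blockPart_cons_of_ne hx] at ht
      exact (ih h.1 hv.of_cons ht).cons x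

/-- The information about a reversed prefix that the algorithm keeps for each block. -/
def SameData (n m : ℕ) (r r' : List ℕ) : Prop :=
  ∀ j, listMax (blockPart m r j) = listMax (blockPart m r' j) ∧
    listMin n (blockPart m r j) = listMin n (blockPart m r' j) ∧
    (blockPart m r j).length = (blockPart m r' j).length ∧
    (¬ BlockFull n m r j → tailPart (blockPart m r j) = tailPart (blockPart m r' j))

theorem SameData.blockFull_iff {n m j : ℕ} {r r' : List ℕ} (h : SameData n m r r')
    (hv : ValidRev n r) (hv' : ValidRev n r') : BlockFull n m r j ↔ BlockFull n m r' j := by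
  rw [_root_.blockFull_iff hv, _root_.blockFull_iff hv', (h j).2.2.1]

theorem SameData.symm {n m : ℕ} {r r' : List ℕ} (h : SameData n m r r')
    (hv : ValidRev n r) (hv' : ValidRev n r') : SameData n m r' r := fun j =>
  ⟨(h j).1.symm, (h j).2.1.symm, (h j).2.2.1.symm,
    fun hf => ((h j).2.2.2 (fun hf' => hf ((h.blockFull_iff hv hv').1 hf'))).symm⟩

theorem SameData.cons {n m x : ℕ} {r r' : List ℕ} (h : SameData n m r r') :
    SameData n m (x :: r) (x :: r') := by
  intro j
  obtain ⟨h1, h2, h3, h4⟩ := h j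
  by_cases hx : x / m = j
  · subst hx
    rw [blockPart_cons_self, blockPart_cons_self]
    refine ⟨congrArg (max x) h1, congrArg (min x) h2, by simp [h3], fun hf => ?_⟩
    rw [tailPart, tailPart, h1, h4 (fun hf' => hf (hf'.cons x))]
  · rw [blockPart_cons_of_ne hx, blockPart_cons_of_ne hx]
    exact ⟨h1, h2, h3, fun hf => h4 (fun hf' => hf (hf'.cons x))⟩

theorem SameData.stepOk {n m x : ℕ} {r r' : List ℕ} (h : SameData n m r r')
    (hv : ValidRev n r) (hv' : ValidRev n r') (hok : StepOk n m r' x) : StepOk n m r x := by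
  intro b hb hxb c hc hbc hcr
  have hle : b / m ≤ c / m := Nat.div_le_div_right hbc.le
  have hle' : x / m ≤ b / m := Nat.div_le_div_right hxb.le
  by_contra hne
  rcases hle.lt_or_eq with hlt | heq
  · have hmax : x < listMax (blockPart m r' (b / m)) := by
      rw [← (h _).1]
      exact lt_listMax.2 ⟨b, mem_blockPart.2 ⟨hb, rfl⟩, hxb⟩
    obtain ⟨b', hb', hxb'⟩ := lt_listMax.1 hmax
    obtain ⟨hb'r, hb'm⟩ := mem_blockPart.1 hb'
    have hf : ¬ BlockFull n m r' (c / m) := by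
      rw [← h.blockFull_iff hv hv']
      exact fun hf => hcr (hf c (by omega) hc rfl)
    unfold BlockFull at hf
    push Not at hf
    obtain ⟨c', -, hc'n, hc'm, hc'r⟩ := hf
    have hbc' : b' < c' := by
      by_contra hcb
      have := Nat.div_le_div_right (c := m) (not_lt.1 hcb)
      omega
    have := hok b' hb'r hxb' c' hc'n hbc' hc'r
    omega
  · have hxj : x / m < b / m := by omega
    have hmin := (h (b / m)).2.1
    have hminle : listMin n (blockPart m r (b / m)) ≤ b :=
      listMin_le_of_mem (mem_blockPart.2 ⟨hb, rfl⟩)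
    set μ := listMin n (blockPart m r (b / m)) with hμ
    have hμmem : μ ∈ blockPart m r' (b / m) := by
      rw [hmin]
      exact listMin_mem (by omega)
    obtain ⟨hμr, hμm⟩ := mem_blockPart.1 hμmem
    have hsub : insert c (blockPart m r (b / m)).toFinset ⊆
        (block n m (b / m)).filter (μ ≤ ·) := by
      intro y hy
      rw [Finset.mem_filter]
      rcases Finset.mem_insert.1 hy with rfl | hy
      · exact ⟨mem_block.2 ⟨⟨by omega, hc⟩, heq.symm⟩, by omega⟩
      · exact ⟨hv.blockPart_subset hy, listMin_le_of_mem (List.mem_toFinset.1 hy)⟩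
    have hcard := Finset.card_le_card hsub
    rw [Finset.card_insert_of_notMem (by simp [mem_blockPart, hcr]),
      List.toFinset_card_of_nodup hv.nodup_blockPart, (h _).2.2.1,
      ← List.toFinset_card_of_nodup hv'.nodup_blockPart] at hcard
    obtain ⟨c', hc', hc'r⟩ := Finset.exists_mem_notMem_of_card_lt_card
      (Nat.lt_of_succ_le hcard)
    obtain ⟨hc'b, hμc⟩ := Finset.mem_filter.1 hc'
    obtain ⟨⟨-, hc'n⟩, hc'm⟩ := mem_block.1 hc'b
    have hc'r' : c' ∉ r' := fun hm => hc'r (List.mem_toFinset.2 (mem_blockPart.2 ⟨hm, hc'm⟩))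
    have hne' : μ ≠ c' := by
      intro he
      exact hc'r' (he ▸ hμr)
    have hxμ : x < μ := by
      by_contra hcb
      have := Nat.div_le_div_right (c := m) (not_lt.1 hcb)
      omega
    have := hok μ hμr hxμ c' hc'n (by omega) hc'r'
    omega

theorem SameData.fullBlockPat_cons {n m x : ℕ} {r r' : List ℕ} (h : SameData n m r r')
    (hv : ValidRev n (x :: r)) (hv' : ValidRev n (x :: r'))
    (hF : FullBlockPat n m r → FullBlockPat n m r') (hp : FullBlockPat n m (x :: r)) :
    FullBlockPat n m (x :: r') := by
  obtain ⟨j, hf, hp⟩ := hp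
  by_cases hx : x / m = j
  · have hf' := (h.cons.blockFull_iff hv hv').1 hf
    refine ⟨j, hf', ?_⟩
    have hnf : ¬ BlockFull n m r j := fun hfr =>
      (List.nodup_cons.1 hv.1).1
        (hfr x (hv.2 x List.mem_cons_self).1 (hv.2 x List.mem_cons_self).2 hx)
    rw [← blockPart_eq_of_full hv hv' hf hf']
    · exact hp
    · subst hx
      rw [blockPart_cons_self, blockPart_cons_self, tailPart, tailPart, (h _).1,
        (h _).2.2.2 hnf]
  · rw [blockPart_cons_of_ne hx] at hp
    obtain ⟨k, hk, hpk⟩ := hF ⟨j, fun c h1 h2 h3 => by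
      rcases List.mem_cons.1 (hf c h1 h2 h3) with rfl | hm
      · exact absurd h3 hx
      · exact hm, hp⟩
    exact ⟨k, hk.cons x, hpk.mono ((List.sublist_cons_self x r').filter _)⟩

/-- `t` is a list of at most `m` values of `[n]` listing the nonempty `tailPart` of a block which
is not yet full, if there is one. -/
def IsPending (n m : ℕ) (r t : List ℕ) : Prop :=
  t.length ≤ m ∧ (∀ y ∈ t, 1 ≤ y ∧ y ≤ n) ∧
    ∀ j, ¬ BlockFull n m r j → tailPart (blockPart m r j) = blockPart m t j

theorem length_blockPart_le {n m j : ℕ} {r : List ℕ} (hm : 0 < m) (hv : ValidRev n r) :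
    (blockPart m r j).length ≤ m := by
  rw [← List.toFinset_card_of_nodup hv.nodup_blockPart]
  have : (blockPart m r j).toFinset ⊆ Finset.Ico (j * m) (j * m + m) := by
    intro y hy
    obtain ⟨-, rfl⟩ := mem_blockPart.1 (List.mem_toFinset.1 hy)
    rw [Finset.mem_Ico]
    exact ⟨Nat.div_mul_le_self y m, Nat.lt_div_mul_add hm⟩
  simpa using Finset.card_le_card this

theorem Live.exists_isPending {n m : ℕ} {r : List ℕ} (hm : 0 < m) (h : Live n m r)
    (hv : ValidRev n r) : ∃ t, IsPending n m r t := by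
  by_cases hex : ∃ j, ¬ BlockFull n m r j ∧ tailPart (blockPart m r j) ≠ []
  · obtain ⟨j, hj, ht⟩ := hex
    have hsub := tailPart_sublist (blockPart m r j)
    refine ⟨tailPart (blockPart m r j), hsub.length_le.trans (length_blockPart_le hm hv),
      fun y hy => hv.2 y (mem_blockPart.1 (hsub.subset hy)).1, fun k hk => ?_⟩
    by_cases hkj : k = j
    · subst hkj
      symm
      refine List.filter_eq_self.2 fun y hy => ?_
      simpa using (mem_blockPart.1 (hsub.subset hy)).2
    · have h1 : tailPart (blockPart m r k) = [] := by
        by_contra hne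
        rcases lt_or_gt_of_ne hkj with hlt | hlt
        · exact hj (h.blockFull_of_tailPart_ne_nil hv hne hlt)
        · exact hk (h.blockFull_of_tailPart_ne_nil hv ht hlt)
      rw [h1]
      symm
      refine List.filter_eq_nil_iff.2 fun y hy => ?_
      have := (mem_blockPart.1 (hsub.subset hy)).2
      simp only [decide_eq_true_eq]
      omega
  · push Not at hex
    exact ⟨[], by simp, by simp, fun j hj => by simpa [blockPart] using hex j hj⟩

/-- A choice of pending list, depending only on the data compared by `SameData`. -/
noncomputable def pending (n m : ℕ) (r : List ℕ) : List ℕ :=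
  Classical.epsilon (IsPending n m r)

theorem SameData.pending_eq {n m : ℕ} {r r' : List ℕ} (h : SameData n m r r')
    (hv : ValidRev n r) (hv' : ValidRev n r') : pending n m r = pending n m r' := by
  have : IsPending n m r = IsPending n m r' := by
    funext t
    refine propext (and_congr_right fun _ => and_congr_right fun _ => forall_congr' fun j => ?_)
    rw [h.blockFull_iff hv hv']
    refine forall_congr' fun hf => ?_
    rw [(h j).2.2.2 (fun hf' => hf ((h.blockFull_iff hv hv').1 hf'))]
  rw [pending, this, pending]

theorem eq_of_getD_eq {m : ℕ} {t t' : List ℕ} (hl : t.length ≤ m) (hl' : t'.length ≤ m)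
    (hp : ∀ y ∈ t, 1 ≤ y) (hp' : ∀ y ∈ t', 1 ≤ y)
    (h : ∀ i < m, t.getD i 0 = t'.getD i 0) : t = t' := by
  induction t generalizing t' m with
  | nil =>
    cases t' with
    | nil => rfl
    | cons y t' =>
      have h0 := h 0 (by simp at hl'; omega)
      have := hp' y List.mem_cons_self
      simp at h0
      omega
  | cons x t ih =>
    cases t' with
    | nil =>
      have h0 := h 0 (by simp at hl; omega)
      have := hp x List.mem_cons_self
      simp at h0
      omega
    | cons y t' =>
      simp only [List.length_cons] at hl hl'
      have h0 := h 0 (by omega)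
      simp only [List.getD_cons_zero] at h0
      rw [h0, ih (m := m - 1) (by omega) (by omega)
        (fun z hz => hp z (List.mem_cons_of_mem _ hz))
        (fun z hz => hp' z (List.mem_cons_of_mem _ hz))
        (fun i hi => by simpa using h (i + 1) (by omega))]

/-- The state space: a dead state, or a flag, the maximum, minimum and number of the entries read
in each block, and the pending list. -/
abbrev State (n m : ℕ) : Type :=
  Option (Prop × (Fin m → Fin (n + 2) × Fin (n + 2) × Fin (n + 2)) × (Fin m → Fin (n + 2)))

open Classical in
/-- The state reached after reading the reversed prefix `r`. -/
noncomputable def stateOf (n m : ℕ) (r : List ℕ) : State n m :=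
  if Live n m r then
    some (FullBlockPat n m r,
      fun i => (Fin.ofNat (n + 2) (listMax (blockPart m r i)),
        Fin.ofNat (n + 2) (listMin n (blockPart m r i)),
        Fin.ofNat (n + 2) (blockPart m r i).length),
      fun i => Fin.ofNat (n + 2) ((pending n m r).getD i 0))
  else none

theorem ofNat_inj_of_lt {N a b : ℕ} (ha : a ≤ N + 1) (hb : b ≤ N + 1)
    (h : Fin.ofNat (N + 2) a = Fin.ofNat (N + 2) b) : a = b := by
  have := congrArg Fin.val h
  simpa [Fin.ofNat, Nat.mod_eq_of_lt (Nat.lt_succ_of_le ha),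
    Nat.mod_eq_of_lt (Nat.lt_succ_of_le hb)] using this

theorem ValidRev.length_le {n : ℕ} {r : List ℕ} (h : ValidRev n r) : r.length ≤ n := by
  rw [← List.toFinset_card_of_nodup h.1]
  have : r.toFinset ⊆ Finset.Icc 1 n := fun y hy =>
    Finset.mem_Icc.2 (h.2 y (List.mem_toFinset.1 hy))
  simpa using Finset.card_le_card this

theorem stateOf_eq_iff {n m : ℕ} (hm : 0 < m) (hnm : n / m < m) {r r' : List ℕ}
    (hv : ValidRev n r) (hv' : ValidRev n r') (hl : Live n m r) (hl' : Live n m r') :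
    stateOf n m r = stateOf n m r' ↔
      (FullBlockPat n m r ↔ FullBlockPat n m r') ∧ SameData n m r r' := by
  rw [stateOf, stateOf, if_pos hl, if_pos hl']
  constructor
  · intro h
    simp only [Option.some.injEq, Prod.mk.injEq, funext_iff] at h
    obtain ⟨hF, hd, hp⟩ := h
    have hpend := Classical.epsilon_spec (hl.exists_isPending hm hv)
    have hpend' := Classical.epsilon_spec (hl'.exists_isPending hm hv')
    change IsPending n m r (pending n m r) at hpend
    change IsPending n m r' (pending n m r') at hpend'
    have hle : ∀ {s}, ValidRev n s → IsPending n m s (pending n m s) → ∀ i,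
        (pending n m s).getD i 0 ≤ n + 1 := by
      intro s _ hs i
      by_cases hi : i < (pending n m s).length
      · rw [List.getD_eq_getElem _ _ hi]
        have := (hs.2.1 _ (List.getElem_mem hi)).2
        omega
      · rw [List.getD_eq_default _ _ (not_lt.1 hi)]
        omega
    have hpe : pending n m r = pending n m r' :=
      eq_of_getD_eq hpend.1 hpend'.1 (fun y hy => (hpend.2.1 y hy).1)
        (fun y hy => (hpend'.2.1 y hy).1)
        (fun i hi => ofNat_inj_of_lt (hle hv hpend i) (hle hv' hpend' i) (hp ⟨i, hi⟩))
    refine ⟨iff_of_eq hF, fun j => ?_⟩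
    by_cases hj : j < m
    · obtain ⟨h1, h2, h3⟩ := hd ⟨j, hj⟩
      have hlen : ∀ {s}, ValidRev n s → (blockPart m s j).length ≤ n + 1 := fun hs =>
        (List.length_filter_le _ _).trans (hs.length_le.trans (Nat.le_succ n))
      have hmx : ∀ {s}, ValidRev n s → listMax (blockPart m s j) ≤ n + 1 := fun hs =>
        (listMax_le fun b hb => (hs.2 b (mem_blockPart.1 hb).1).2).trans (Nat.le_succ n)
      have h3 := ofNat_inj_of_lt (hlen hv) (hlen hv') h3
      refine ⟨ofNat_inj_of_lt (hmx hv) (hmx hv') h1,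
        ofNat_inj_of_lt (listMin_le _ _) (listMin_le _ _) h2, h3, fun hf => ?_⟩
      have hf' : ¬ BlockFull n m r' j := by
        rw [blockFull_iff hv', ← h3, ← blockFull_iff hv]
        exact hf
      rw [hpend.2.2 j hf, hpend'.2.2 j hf', hpe]
    · have hnil : ∀ {s}, ValidRev n s → blockPart m s j = [] := by
        intro s hs
        refine List.filter_eq_nil_iff.2 fun y hy => ?_
        have := Nat.div_le_div_right (c := m) (hs.2 y hy).2
        simp only [decide_eq_true_eq]
        omega
      rw [hnil hv, hnil hv']
      simp
  · rintro ⟨hF, hd⟩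
    rw [hd.pending_eq hv hv', propext hF]
    congr 4
    funext i
    rw [(hd i).1, (hd i).2.1, (hd i).2.2.1]

theorem stateOf_cons_eq {n m : ℕ} (hm : 0 < m) (hnm : n / m < m) {r r' : List ℕ} {x : ℕ}
    (hv : ValidRev n (x :: r)) (hv' : ValidRev n (x :: r'))
    (h : stateOf n m r = stateOf n m r') : stateOf n m (x :: r) = stateOf n m (x :: r') := by
  by_cases hl : Live n m r
  · by_cases hl' : Live n m r'
    · obtain ⟨hF, hd⟩ := (stateOf_eq_iff hm hnm hv.of_cons hv'.of_cons hl hl').1 h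
      have hd' := hd.symm hv.of_cons hv'.of_cons
      by_cases hx : StepOk n m r x
      · have hx' := hd'.stepOk hv'.of_cons hv.of_cons hx
        exact (stateOf_eq_iff hm hnm hv hv' ⟨hl, hx⟩ ⟨hl', hx'⟩).2
          ⟨⟨hd.fullBlockPat_cons hv hv' hF.1, hd'.fullBlockPat_cons hv' hv hF.2⟩, hd.cons⟩
      · have hx' : ¬ StepOk n m r' x := fun hx' => hx (hd.stepOk hv.of_cons hv'.of_cons hx')
        rw [stateOf, stateOf, if_neg (fun h => hx h.2), if_neg (fun h => hx' h.2)]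
    · rw [stateOf, stateOf, if_pos hl, if_neg hl'] at h
      exact absurd h (by simp)
  · by_cases hl' : Live n m r'
    · rw [stateOf, stateOf, if_neg hl, if_pos hl'] at h
      exact absurd h (by simp)
    · rw [stateOf, stateOf, if_neg (fun h => hl h.1), if_neg (fun h => hl' h.1)]

theorem exists_streamAlg_hasPat {n m : ℕ} (hm : 0 < m) (hnm : n / m < m) :
    ∃ A : StreamAlg (State n m), ∀ τ, IsPermOf n τ → (A.Accepts τ ↔ HasPat τ.reverse) := by
  refine exists_streamAlg_of_congruence n (stateOf n m) (fun τ => HasPat τ.reverse)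
    (fun r r' x hv hv' h => stateOf_cons_eq hm hnm hv hv' h) fun τ τ' hτ hτ' h hP => ?_
  have hall : ∀ {σ}, IsPermOf n σ → ∀ c, 1 ≤ c → c ≤ n → c ∈ σ.reverse := by
    intro σ hσ c h1 h2
    rw [List.mem_reverse, hσ.mem_iff, List.mem_range'_1]
    omega
  have hv := validRev_reverse hτ
  have hv' := validRev_reverse hτ'
  rw [hasPat_iff (m := m) hv (hall hτ)] at hP
  rw [hasPat_iff (m := m) hv' (hall hτ')]
  by_cases hl' : Live n m τ'.reverse
  · by_cases hl : Live n m τ.reverse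
    · exact Or.inr (((stateOf_eq_iff hm hnm hv hv' hl hl').1 h).1.1
        (hP.resolve_left (not_not.2 hl)))
    · rw [stateOf, stateOf, if_neg hl, if_pos hl'] at h
      exact absurd h (by simp)
  · exact Or.inl hl'

theorem contains_iff_sublist {τ : List ℕ} {p q s : ℕ} :
    Contains τ [p, q, s] ↔ ∃ x y z, [x, y, z].Sublist τ ∧
      (x < y ↔ p < q) ∧ (x < z ↔ p < s) ∧ (y < x ↔ q < p) ∧ (y < z ↔ q < s) ∧
      (z < x ↔ s < p) ∧ (z < y ↔ s < q) := by
  constructor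
  · rintro ⟨f, hf, h⟩
    refine ⟨τ.get (f 0), τ.get (f 1), τ.get (f 2), ?_, h 0 1, h 0 2, h 1 0, h 1 2, h 2 0, h 2 1⟩
    rw [List.sublist_iff_exists_fin_orderEmbedding_get_eq]
    refine ⟨OrderEmbedding.ofStrictMono f hf, fun i => ?_⟩
    match i with
    | 0 => rfl
    | 1 => rfl
    | 2 => rfl
  · rintro ⟨x, y, z, hs, h⟩
    rw [List.sublist_iff_exists_fin_orderEmbedding_get_eq] at hs
    obtain ⟨f, hf⟩ := hs
    refine ⟨f, f.strictMono, fun i j => ?_⟩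
    have hi := hf i
    have hj := hf j
    change τ.get (f i) < τ.get (f j) ↔ _
    rw [← hi, ← hj]
    match i, j with
    | 0, 0 => simp
    | 0, 1 => exact h.1
    | 0, 2 => exact h.2.1
    | 1, 0 => exact h.2.2.1
    | 1, 1 => simp
    | 1, 2 => exact h.2.2.2.1
    | 2, 0 => exact h.2.2.2.2.1
    | 2, 1 => exact h.2.2.2.2.2
    | 2, 2 => simp

theorem contains_213_iff {τ : List ℕ} : Contains τ [2, 1, 3] ↔ HasPat τ.reverse := by
  rw [contains_iff_sublist]
  constructor
  · rintro ⟨b, a, c, hs, h⟩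
    exact ⟨a, b, c, by omega, by omega, by simpa using hs.reverse⟩
  · rintro ⟨a, b, c, hab, hbc, hs⟩
    exact ⟨b, a, c, by simpa using hs.reverse, by omega⟩

theorem contains_231_iff {n : ℕ} {τ : List ℕ} (hτ : ∀ x ∈ τ, x ≤ n) :
    Contains τ [2, 3, 1] ↔ Contains (τ.map (n + 1 - ·)) [2, 1, 3] := by
  rw [contains_iff_sublist, contains_iff_sublist]
  constructor
  · rintro ⟨b, c, a, hs, h⟩
    have hb := hτ b (hs.subset (by simp))
    have hc := hτ c (hs.subset (by simp))
    have ha := hτ a (hs.subset (by simp))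
    exact ⟨n + 1 - b, n + 1 - c, n + 1 - a, hs.map (n + 1 - ·), by omega⟩
  · rintro ⟨b, a, c, hs, h⟩
    obtain ⟨l, hl, he⟩ := List.sublist_map_iff.1 hs
    match l, he with
    | [x, y, z], he =>
      simp only [List.map_cons, List.map_nil, List.cons.injEq, and_true] at he
      have hx := hτ x (hl.subset (by simp))
      have hy := hτ y (hl.subset (by simp))
      have hz := hτ z (hl.subset (by simp))
      exact ⟨x, y, z, hl, by omega⟩

theorem IsPermOf.map_complement {n : ℕ} {τ : List ℕ} (hτ : IsPermOf n τ) :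
    IsPermOf n (τ.map (n + 1 - ·)) := by
  have hmem : ∀ x, x ∈ τ ↔ 1 ≤ x ∧ x ≤ n := by
    intro x
    rw [hτ.mem_iff, List.mem_range'_1]
    omega
  have hnd : τ.Nodup := hτ.nodup_iff.2 List.nodup_range'
  unfold IsPermOf
  rw [List.perm_ext_iff_of_nodup _ List.nodup_range']
  · intro y
    rw [List.mem_map, List.mem_range'_1]
    constructor
    · rintro ⟨x, hx, rfl⟩
      have := (hmem x).1 hx
      omega
    · intro hy
      exact ⟨n + 1 - y, (hmem _).2 (by omega), by omega⟩
  · refine hnd.map_on fun x hx y hy h => ?_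
    have := (hmem x).1 hx
    have := (hmem y).1 hy
    omega

theorem exists_streamAlg_solvesPPM {n m : ℕ} (hm : 0 < m) (hnm : n / m < m) {π : List ℕ}
    (hπ : π = [2, 3, 1] ∨ π = [2, 1, 3]) : ∃ A : StreamAlg (State n m), SolvesPPM A n π := by
  obtain ⟨A, hA⟩ := exists_streamAlg_hasPat hm hnm
  rcases hπ with rfl | rfl
  · refine ⟨⟨A.q0, A.F, fun q x => A.t q (n + 1 - x)⟩, fun τ hτ => ?_⟩
    rw [contains_231_iff (n := n), contains_213_iff, ← hA _ hτ.map_complement]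
    · simp [StreamAlg.Accepts, StreamAlg.run, List.foldl_map]
    · intro x hx
      have := hτ.mem_iff.1 hx
      rw [List.mem_range'_1] at this
      omega
  · exact ⟨A, fun τ hτ => by rw [contains_213_iff, hA τ hτ]⟩

theorem card_state (n m : ℕ) : Fintype.card (State n m) = 2 * (n + 2) ^ (4 * m) + 1 := by
  simp only [State, Fintype.card_option, Fintype.card_prod, Fintype.card_prop, Fintype.card_fun,
    Fintype.card_fin]
  rw [← mul_pow, pow_mul]
  ring

theorem card_state_le {n : ℕ} (hn : 2 ≤ n) :
    (Fintype.card (State n (Nat.sqrt n + 1)) : ℝ) ≤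
      2 ^ ((18 : ℝ) * Real.sqrt n * Real.logb 2 n) := by
  have hn' : (2 : ℝ) ≤ n := by exact_mod_cast hn
  have h1 : Fintype.card (State n (Nat.sqrt n + 1)) ≤ n ^ (8 * (Nat.sqrt n + 1) + 2) := by
    rw [card_state]
    have h2 : n + 2 ≤ n ^ 2 := by nlinarith
    have h3 : (n + 2) ^ (4 * (Nat.sqrt n + 1)) ≤ n ^ (8 * (Nat.sqrt n + 1)) := by
      calc (n + 2) ^ (4 * (Nat.sqrt n + 1)) ≤ (n ^ 2) ^ (4 * (Nat.sqrt n + 1)) :=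
            Nat.pow_le_pow_left h2 _
        _ = n ^ (8 * (Nat.sqrt n + 1)) := by rw [← pow_mul]; ring_nf
    have h4 : 1 ≤ n ^ (8 * (Nat.sqrt n + 1)) := Nat.one_le_pow _ _ (by omega)
    rw [pow_add]
    nlinarith
  have h2 : (2 : ℝ) ^ ((18 : ℝ) * Real.sqrt n * Real.logb 2 n) =
      (n : ℝ) ^ ((18 : ℝ) * Real.sqrt n) := by
    rw [mul_comm, Real.rpow_mul (by norm_num), Real.rpow_logb (by norm_num) (by norm_num)
      (by linarith)]
  rw [h2]
  refine (Nat.cast_le.2 h1).trans ?_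
  rw [Nat.cast_pow, ← Real.rpow_natCast]
  refine Real.rpow_le_rpow_of_exponent_le (by linarith) ?_
  have h3 : (Nat.sqrt n : ℝ) ≤ Real.sqrt n := Real.nat_sqrt_le_real_sqrt
  have h4 : (1 : ℝ) ≤ Real.sqrt n := Real.one_le_sqrt.2 (by linarith)
  push_cast
  linarith

/-- There is a constant `C` such that for every `n ≥ 2` and each
`π ∈ {231, 213}`, there is a deterministic single-pass streaming algorithm solving `π`-PPM_n
using at most `C·√n·log₂ n` bits of space, i.e. having at most `2^{C·√n·log₂ n}` states. -/
theorem stmt18 :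
    ∃ C : ℝ, 0 < C ∧
      ∀ n : ℕ, 2 ≤ n →
        ∀ π : List ℕ, (π = [2, 3, 1] ∨ π = [2, 1, 3]) →
          ∃ (Q : Type) (inst : Fintype Q) (A : StreamAlg Q),
            SolvesPPM A n π ∧
            (@Fintype.card Q inst : ℝ) ≤ 2 ^ (C * Real.sqrt n * Real.logb 2 n) := by
  refine ⟨18, by norm_num, fun n hn π hπ => ?_⟩
  obtain ⟨A, hA⟩ := exists_streamAlg_solvesPPM (n := n) (Nat.succ_pos (Nat.sqrt n))
    ((Nat.div_lt_iff_lt_mul (Nat.succ_pos _)).2 (Nat.lt_succ_sqrt n)) hπ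
  exact ⟨_, inferInstance, A, hA, card_state_le hn⟩
end

section
/- Let π be a pattern of length at most 3 and let n ≥ 1. Then there exist functions A mapping finite sequences over [n] to {0, 1} and B mapping {0, 1} × (finite sequences over [n]) to {0, 1} such that for every permutation τ of [n] and every way of writing τ = αβ as a concatenation of a prefix α and a suffix β, one has B(A(α), β) = 1 if and only if τ contains π. In other words, the one-way two-party communication complexity of π-PPM_n is one bit for |π| ≤ 3. -/
/-- The sequence `s` is order-isomorphic to the pattern `π`. -/
def OrderIsomorphic (s π : List ℕ) : Prop :=
  ∃ h : π.length = s.length, ∀ j l : Fin π.length,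
    (s.get (j.cast h) < s.get (l.cast h) ↔ π.get j < π.get l)

/-- Containment of a pattern, phrased with sublists. -/
theorem contains_iff_exists_sublist (τ π : List ℕ) :
    Contains τ π ↔ ∃ s : List ℕ, s.Sublist τ ∧ OrderIsomorphic s π := by
  constructor
  · rintro ⟨f, hf, hπ⟩
    have hlen : π.length = (List.ofFn fun j => τ.get (f j)).length := by simp
    refine ⟨List.ofFn fun j => τ.get (f j), ?_, hlen, ?_⟩
    · rw [List.sublist_iff_exists_fin_orderEmbedding_get_eq]
      refine ⟨OrderEmbedding.ofStrictMono (fun j => f (j.cast hlen.symm)) ?_, ?_⟩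
      · intro a b hab
        exact hf hab
      · intro j
        simp [Fin.cast]
    · intro j l
      simpa using hπ j l
  · rintro ⟨s, hs, hlen, hπ⟩
    obtain ⟨g, hg⟩ := List.sublist_iff_exists_fin_orderEmbedding_get_eq.mp hs
    refine ⟨fun j => g (j.cast hlen), ?_, ?_⟩
    · intro a b hab
      exact g.strictMono hab
    · intro j l
      rw [← hg, ← hg]
      exact hπ j l

/-- A list with at most one entry that is a sublist of `l` is a sublist of every
rearrangement of `l`. -/
theorem List.Sublist.of_perm_of_length_le_one {γ : Type*} {s l l' : List γ} (hs : s.Sublist l)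
    (h : l.Perm l') (hlen : s.length ≤ 1) : s.Sublist l' := by
  match s, hlen with
  | [], _ => exact List.nil_sublist l'
  | [x], _ => exact List.singleton_sublist.mpr (h.mem_iff.mp (List.singleton_sublist.mp hs))

/-- For every pattern `π` of length at most 3 and every `n ≥ 1`, there are
functions `A` (Alice's one-bit message, computed from her prefix) and `B` (Bob's decision,
computed from the message and his suffix) such that for every permutation `τ` of `[n]` and
every split `τ = α ++ β`, Bob's output is 1 iff `τ` contains `π`. In other words, the one-way
two-party communication complexity of `π`-PPM_n is one bit for `|π| ≤ 3`. -/
theorem stmt19 (π : List ℕ) (hπ : IsPattern π) (hlen : π.length ≤ 3) (n : ℕ) (hn : 1 ≤ n) :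
    ∃ (A : List ℕ → Bool) (B : Bool → List ℕ → Bool),
      ∀ α β : List ℕ, IsPermOf n (α ++ β) →
        (B (A α) β = true ↔ Contains (α ++ β) π) := by
  classical
  refine ⟨fun α => decide (∃ β, IsPermOf n (α ++ β) ∧ ∃ s t : List ℕ, s.Sublist α ∧
      t.Sublist β ∧ t.length ≤ 1 ∧ OrderIsomorphic (s ++ t) π),
    fun b β => b || decide (∃ α, IsPermOf n (α ++ β) ∧ ∃ s t : List ℕ, s.Sublist α ∧
      t.Sublist β ∧ s.length ≤ 1 ∧ OrderIsomorphic (s ++ t) π), fun α β hτ => ?_⟩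
  rw [contains_iff_exists_sublist, Bool.or_eq_true, decide_eq_true_iff, decide_eq_true_iff]
  constructor
  · rintro (⟨β', hβ', s, t, hs, ht, hle, hst⟩ | ⟨α', hα', s, t, hs, ht, hle, hst⟩)
    · have hperm : β'.Perm β := (List.perm_append_left_iff α).mp (hβ'.trans hτ.symm)
      exact ⟨s ++ t, hs.append (ht.of_perm_of_length_le_one hperm hle), hst⟩
    · have hperm : α'.Perm α := (List.perm_append_right_iff β).mp (hα'.trans hτ.symm)
      exact ⟨s ++ t, (hs.of_perm_of_length_le_one hperm hle).append ht, hst⟩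
  · rintro ⟨u, hu, hiso⟩
    obtain ⟨s, t, rfl, hs, ht⟩ := List.sublist_append_iff.mp hu
    have hst : π.length = s.length + t.length := by simpa using hiso.1
    by_cases hle : t.length ≤ 1
    · exact Or.inl ⟨β, hτ, s, t, hs, ht, hle, hiso⟩
    · exact Or.inr ⟨α, hτ, s, t, hs, ht, by omega, hiso⟩
end
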